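/- arXiv:1502.05146 — 4 statements merged into one kernel-verified Lean document; each statement's English description precedes it below -/
import Mathlib

section
/- Let Γ₁ and Γ₂ be countable homogeneous structures with disjoint relational signatures τ₁ and τ₂, such that for i = 1, 2 the automorphism group of Γᵢ is oligomorphic, Γᵢ has no algebraicity, and the age of Γᵢ has the Ramsey property. Then every countable homogeneous (τ₁ ∪ τ₂)-structure whose age equals the free superposition of the ages of Γ₁ and Γ₂ (the class of finite (τ₁ ∪ τ₂)-structures whose τᵢ-reduct embeds into Γᵢ for i = 1, 2) has age with the Ramsey property. -/
open FirstOrder FirstOrder.Language CategoryTheory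

universe u v u' v' w

/-- The partition arrow `C → (B)^A_r`. -/
def RamseyArrow (L : FirstOrder.Language.{u, v}) (C B A : Type w)
    [L.Structure C] [L.Structure B] [L.Structure A] (r : ℕ) : Prop :=
  ∀ χ : (A ↪[L] C) → Fin r, ∃ f : B ↪[L] C,
    ∀ e₁ e₂ : A ↪[L] B, χ (f.comp e₁) = χ (f.comp e₂)

/-- The age of `Γ`: the class of all finite structures that embed into `Γ`. -/
def FinAge (L : FirstOrder.Language.{u, v}) (Γ : Type w) [L.Structure Γ] :
    Set (Bundled.{w} L.Structure) :=
  {A | Finite A ∧ Nonempty (A ↪[L] Γ)}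

/-- The Ramsey property for a class of finite structures. -/
def HasRamseyProperty (L : FirstOrder.Language.{u, v})
    (K : Set (Bundled.{w} L.Structure)) : Prop :=
  ∀ A ∈ K, ∀ B ∈ K, ∀ r : ℕ, ∃ C ∈ K, RamseyArrow L C B A r

/-- `Γ` is homogeneous. -/
def IsHomogeneous (L : FirstOrder.Language.{u, v}) (Γ : Type w) [L.Structure Γ] : Prop :=
  ∀ A : Bundled.{w} L.Structure, Finite A → ∀ f g : A ↪[L] Γ,
    ∃ α : Γ ≃[L] Γ, ∀ a : A, α (f a) = g a

/-- The automorphism group of `Γ` is oligomorphic: for each `n` there are finitely many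
orbits of `n`-tuples. -/
def Oligomorphic (L : FirstOrder.Language.{u, v}) (Γ : Type w) [L.Structure Γ] : Prop :=
  ∀ n : ℕ, Set.Finite {O : Set (Fin n → Γ) |
    ∃ t : Fin n → Γ, O = {u | ∃ g : Γ ≃[L] Γ, u = ⇑g ∘ t}}

/-- `Γ` has no algebraicity: the pointwise stabiliser of any finite tuple fixes no other
element of the domain. -/
def NoAlgebraicity (L : FirstOrder.Language.{u, v}) (Γ : Type w) [L.Structure Γ] : Prop :=
  ∀ (n : ℕ) (a : Fin n → Γ) (b : Γ), (∀ i, b ≠ a i) →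
    ∃ g : Γ ≃[L] Γ, (∀ i, g (a i) = a i) ∧ g b ≠ b

/-- The `τ₁`-reduct of a structure in the disjoint union signature. -/
def reductL {L₁ : FirstOrder.Language.{u, v}} {L₂ : FirstOrder.Language.{u', v'}}
    (M : Bundled.{w} (L₁.sum L₂).Structure) : Bundled.{w} L₁.Structure :=
  ⟨M, (LHom.sumInl : L₁ →ᴸ L₁.sum L₂).reduct M⟩

/-- The `τ₂`-reduct of a structure in the disjoint union signature. -/
def reductR {L₁ : FirstOrder.Language.{u, v}} {L₂ : FirstOrder.Language.{u', v'}}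
    (M : Bundled.{w} (L₁.sum L₂).Structure) : Bundled.{w} L₂.Structure :=
  ⟨M, (LHom.sumInr : L₂ →ᴸ L₁.sum L₂).reduct M⟩

/-- The free superposition of two classes. -/
def Superposition (L₁ : FirstOrder.Language.{u, v}) (L₂ : FirstOrder.Language.{u', v'})
    (C₁ : Set (Bundled.{w} L₁.Structure)) (C₂ : Set (Bundled.{w} L₂.Structure)) :
    Set (Bundled.{w} (L₁.sum L₂).Structure) :=
  {M | reductL M ∈ C₁ ∧ reductR M ∈ C₂}

theorem blowup (L : FirstOrder.Language.{u, v}) [L.IsRelational]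
    (Γ : Type w) [L.Structure Γ] (halg : NoAlgebraicity L Γ)
    (C : Type w) [L.Structure C] [Finite C] (ι : C ↪[L] Γ)
    (X : Type w) [Finite X] (p : X → C) (σ : C → X) (hσ : ∀ c, p (σ c) = c) (t : Finset X) :
    ∃ φ : X → Γ, Set.InjOn φ (Set.range σ ∪ ↑t) ∧
      ∀ (n : ℕ) (R : L.Relations n) (x : Fin n → X), (∀ i, x i ∈ Set.range σ ∪ (↑t : Set X)) →
        (∀ i j, p (x i) = p (x j) → x i = x j) →
        (Structure.RelMap R (φ ∘ x) ↔ Structure.RelMap R (p ∘ x)) := by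
  classical
  induction t using Finset.induction_on with
  | empty =>
    refine ⟨ι ∘ p, ?_, ?_⟩
    · rintro _ (⟨c, rfl⟩ | h) _ (⟨d, rfl⟩ | h') h''
      · simp only [Function.comp, hσ] at h''
        rw [ι.injective h'']
      all_goals simp_all
    · intro n R x _ _
      exact ι.map_rel R (p ∘ x)
  | insert x t hxt ih =>
    obtain ⟨φ, hinj, hrel⟩ := ih
    set S : Set X := Set.range σ ∪ (↑t : Set X) with hS
    have hS' : Set.range σ ∪ (↑(insert x t) : Set X) = insert x S := by
      rw [Finset.coe_insert, Set.union_insert]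
    rw [hS']
    by_cases hxS : x ∈ S
    · rw [Set.insert_eq_of_mem hxS]
      exact ⟨φ, hinj, hrel⟩
    set y := σ (p x) with hy
    have hyS : y ∈ S := Or.inl ⟨_, rfl⟩
    have hpy : p y = p x := hσ _
    obtain ⟨m, ⟨eqv⟩⟩ := Finite.exists_equiv_fin {z // z ∈ S ∧ z ≠ y}
    obtain ⟨g, hg, hgb⟩ := halg m (fun i => φ (eqv.symm i).1) (φ y) (by
      intro i h
      exact (eqv.symm i).2.2 (hinj hyS (eqv.symm i).2.1 h).symm)
    have hg' : ∀ z ∈ S, z ≠ y → g (φ z) = φ z := by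
      intro z hz hzy
      have := hg (eqv ⟨z, hz, hzy⟩)
      simpa using this
    have hnew : ∀ z ∈ S, φ z ≠ g (φ y) := by
      intro z hz h
      by_cases hzy : z = y
      · subst hzy; exact hgb h.symm
      · rw [← hg' z hz hzy] at h
        exact hzy (hinj hz hyS (g.injective h))
    have hne : ∀ z ∈ S, z ≠ x := fun z hz h => hxS (h ▸ hz)
    have hupd : ∀ z ∈ S, Function.update φ x (g (φ y)) z = φ z := fun z hz =>
      Function.update_of_ne (hne z hz) _ _
    refine ⟨Function.update φ x (g (φ y)), ?_, ?_⟩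
    · rintro a (rfl | ha) b (rfl | hb) hab
      · rfl
      · rw [hupd b hb, Function.update_self] at hab
        exact absurd hab.symm (hnew b hb)
      · rw [hupd a ha, Function.update_self] at hab
        exact absurd hab (hnew a ha)
      · rw [hupd a ha, hupd b hb] at hab
        exact hinj ha hb hab
    · intro n R z hz htr
      by_cases hx : ∃ i, z i = x
      · obtain ⟨i₀, hi₀⟩ := hx
        have hzy : ∀ i, z i ≠ y := by
          intro i h
          have := htr i i₀ (by rw [h, hi₀, hpy])
          rw [h, hi₀] at this
          exact hne y hyS this
        let z' : Fin n → X := fun i => if z i = x then y else z i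
        have hpz : p ∘ z' = p ∘ z := by
          funext i
          by_cases h : z i = x <;> simp [z', h, hpy]
        have hpz' : ∀ i, p (z' i) = p (z i) := fun i => congrFun hpz i
        have h1 := hrel n R z' (by
          intro i
          by_cases h : z i = x
          · simpa [z', h] using hyS
          · simpa [z', h] using (hz i).resolve_left h) (by
          intro i j hij
          rw [hpz', hpz'] at hij
          simp only [z', htr i j hij])
        rw [← hpz, ← h1, ← g.map_rel R (φ ∘ z')]
        have : Function.update φ x (g (φ y)) ∘ z = g ∘ φ ∘ z' := by
          funext i
          by_cases h : z i = x
          · simp [z', h]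
          · have hi := (hz i).resolve_left h
            simp [z', h, hg' _ hi (hzy i)]
        rw [this]
      · push Not at hx
        have hzS : ∀ i, z i ∈ S := fun i => (hz i).resolve_left (hx i)
        have : Function.update φ x (g (φ y)) ∘ z = φ ∘ z := by
          funext i
          exact hupd _ (hzS i)
        rw [this]
        exact hrel n R z hzS htr

/-- Blow-up of each point of `C` along a finite type, as a structure in the age. -/
theorem blowup' (L : FirstOrder.Language.{u, v}) [L.IsRelational]
    (Γ : Type w) [L.Structure Γ] (halg : NoAlgebraicity L Γ)
    (C : Type w) [L.Structure C] [Finite C] (ι : C ↪[L] Γ)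
    (X : Type w) [Finite X] (p : X → C) :
    ∃ S : L.Structure X, Nonempty (@Embedding L X Γ S _) ∧
      ∀ (n : ℕ) (R : L.Relations n) (x : Fin n → X),
        (∀ i j, p (x i) = p (x j) → x i = x j) →
        (S.RelMap R x ↔ Structure.RelMap R (p ∘ x)) := by
  classical
  have := Fintype.ofFinite (X ⊕ C)
  obtain ⟨φ, hinj, hrel⟩ := blowup L Γ halg C ι (X ⊕ C) (Sum.elim p id) Sum.inr (fun _ => rfl)
    Finset.univ
  let S : L.Structure X :=
    { funMap := fun f => isEmptyElim f
      RelMap := fun R x => Structure.RelMap R (φ ∘ Sum.inl ∘ x) }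
  refine ⟨S, ⟨⟨⟨φ ∘ Sum.inl, ?_⟩, fun f => isEmptyElim f, fun R x => Iff.rfl⟩⟩, ?_⟩
  · intro a b h
    exact Sum.inl_injective (hinj (by simp) (by simp) h)
  · intro n R x hx
    exact hrel n R (Sum.inl ∘ x) (by simp) (by
      intro i j h
      exact congrArg Sum.inl (hx i j h))

/-- Pairing of embeddings of the reducts. -/
theorem pairEmb {L₁ : FirstOrder.Language.{u, v}} {L₂ : FirstOrder.Language.{u', v'}}
    [L₁.IsRelational] [L₂.IsRelational]
    {C₁ C₂ : Type w} [L₁.Structure C₁] [L₂.Structure C₂]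
    (S₁ : L₁.Structure (C₁ × C₂)) (S₂ : L₂.Structure (C₁ × C₂))
    (h₁ : ∀ (n : ℕ) (R : L₁.Relations n) (x : Fin n → C₁ × C₂),
        (∀ i j, (x i).1 = (x j).1 → x i = x j) →
        (S₁.RelMap R x ↔ Structure.RelMap R (Prod.fst ∘ x)))
    (h₂ : ∀ (n : ℕ) (R : L₂.Relations n) (x : Fin n → C₁ × C₂),
        (∀ i j, (x i).2 = (x j).2 → x i = x j) →
        (S₂.RelMap R x ↔ Structure.RelMap R (Prod.snd ∘ x)))
    (A : Bundled.{w} (L₁.sum L₂).Structure)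
    (e₁ : reductL A ↪[L₁] C₁) (e₂ : reductR A ↪[L₂] C₂) :
    ∃ e : @Embedding (L₁.sum L₂) A (C₁ × C₂) _ (@sumStructure L₁ L₂ (C₁ × C₂) S₁ S₂),
      ∀ a : A, e a = (e₁ a, e₂ a) := by
  letI := @sumStructure L₁ L₂ (C₁ × C₂) S₁ S₂
  refine ⟨⟨⟨fun a => (e₁ a, e₂ a), ?_⟩, fun f => isEmptyElim f, ?_⟩, fun a => rfl⟩
  · intro a b h
    exact e₁.injective (congrArg Prod.fst h)
  · rintro n (R | R) x
    · refine (h₁ n R (fun i => (e₁ (x i), e₂ (x i))) ?_).trans (e₁.map_rel R x)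
      intro i j h
      have := e₁.injective h
      simp only [this]
    · refine (h₂ n R (fun i => (e₁ (x i), e₂ (x i))) ?_).trans (e₂.map_rel R x)
      intro i j h
      have := e₂.injective h
      simp only [this]

/-- Reduct of an embedding. -/
def embL {L₁ : FirstOrder.Language.{u, v}} {L₂ : FirstOrder.Language.{u', v'}}
    [L₁.IsRelational] {A B : Bundled.{w} (L₁.sum L₂).Structure} (e : A ↪[L₁.sum L₂] B) :
    reductL A ↪[L₁] reductL B :=
  ⟨e.toEmbedding, fun f => isEmptyElim f, fun R x => e.map_rel (Sum.inl R) x⟩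

/-- Reduct of an embedding. -/
def embR {L₁ : FirstOrder.Language.{u, v}} {L₂ : FirstOrder.Language.{u', v'}}
    [L₂.IsRelational] {A B : Bundled.{w} (L₁.sum L₂).Structure} (e : A ↪[L₁.sum L₂] B) :
    reductR A ↪[L₂] reductR B :=
  ⟨e.toEmbedding, fun f => isEmptyElim f, fun R x => e.map_rel (Sum.inr R) x⟩

/-- If `Γ₁`, `Γ₂` are countable homogeneous structures over disjoint relational signatures,
with oligomorphic automorphism groups, no algebraicity and Ramsey ages, then any countable
homogeneous structure whose age is the free superposition of the two ages has Ramsey age. -/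
theorem stmt11 (L₁ : FirstOrder.Language.{u, v}) (L₂ : FirstOrder.Language.{u', v'})
    [L₁.IsRelational] [L₂.IsRelational]
    (Γ₁ : Type w) [L₁.Structure Γ₁] [Countable Γ₁]
    (Γ₂ : Type w) [L₂.Structure Γ₂] [Countable Γ₂]
    (hhom₁ : IsHomogeneous L₁ Γ₁) (hhom₂ : IsHomogeneous L₂ Γ₂)
    (holig₁ : Oligomorphic L₁ Γ₁) (holig₂ : Oligomorphic L₂ Γ₂)
    (halg₁ : NoAlgebraicity L₁ Γ₁) (halg₂ : NoAlgebraicity L₂ Γ₂)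
    (hram₁ : HasRamseyProperty L₁ (FinAge L₁ Γ₁))
    (hram₂ : HasRamseyProperty L₂ (FinAge L₂ Γ₂))
    (Δ : Type w) [(L₁.sum L₂).Structure Δ] [Countable Δ]
    (hhomΔ : IsHomogeneous (L₁.sum L₂) Δ)
    (hage : FinAge (L₁.sum L₂) Δ = Superposition L₁ L₂ (FinAge L₁ Γ₁) (FinAge L₂ Γ₂)) :
    HasRamseyProperty (L₁.sum L₂) (FinAge (L₁.sum L₂) Δ) := by
  intro A hA B hB r
  by_cases hAB : Nonempty (A ↪[L₁.sum L₂] B)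
  swap
  · refine ⟨B, hB, fun χ => ⟨Embedding.refl _ _, fun e => absurd ⟨e⟩ hAB⟩⟩
  obtain ⟨g₀⟩ := hAB
  rw [hage] at hA hB ⊢
  obtain ⟨C₂, ⟨hfin₂, ⟨ι₂⟩⟩, hC₂⟩ := hram₂ _ hA.2 _ hB.2 r
  have : Finite (reductR A) := hA.2.1
  have : Finite (reductR A ↪[L₂] C₂) := DFunLike.finite _
  have : Finite ((reductR A ↪[L₂] C₂) → Fin r) := inferInstance
  obtain ⟨k, ⟨eqv⟩⟩ := Finite.exists_equiv_fin ((reductR A ↪[L₂] C₂) → Fin r)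
  obtain ⟨C₁, ⟨hfin₁, ⟨ι₁⟩⟩, hC₁⟩ := hram₁ _ hA.1 _ hB.1 k
  obtain ⟨S₁, ⟨j₁⟩, h₁⟩ := blowup' L₁ Γ₁ halg₁ C₁ ι₁ (C₁ × C₂) Prod.fst
  obtain ⟨S₂, ⟨j₂⟩, h₂⟩ := blowup' L₂ Γ₂ halg₂ C₂ ι₂ (C₁ × C₂) Prod.snd
  letI S := @sumStructure L₁ L₂ (C₁ × C₂) S₁ S₂
  have hfin : Finite (C₁ × C₂) := inferInstance
  refine ⟨⟨C₁ × C₂, S⟩, ⟨⟨hfin, ⟨?_⟩⟩, ⟨hfin, ⟨?_⟩⟩⟩, ?_⟩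
  · exact ⟨j₁.toEmbedding, fun f => isEmptyElim f, fun R x => j₁.map_rel R x⟩
  · exact ⟨j₂.toEmbedding, fun f => isEmptyElim f, fun R x => j₂.map_rel R x⟩
  intro χ
  choose pA hpA using pairEmb S₁ S₂ h₁ h₂ A
  choose pB hpB using pairEmb S₁ S₂ h₁ h₂ B
  obtain ⟨f₁, hf₁⟩ := hC₁ (fun e₁ => eqv (fun e₂ => χ (pA e₁ e₂)))
  obtain ⟨f₂, hf₂⟩ := hC₂ (fun e₂ => χ (pA (f₁.comp (embL g₀)) e₂))
  refine ⟨pB f₁ f₂, ?_⟩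
  have key : ∀ e : A ↪[L₁.sum L₂] B, (pB f₁ f₂).comp e =
      pA (f₁.comp (embL e)) (f₂.comp (embR e)) := by
    intro e
    apply Embedding.ext
    intro a
    exact (hpB f₁ f₂ (e a)).trans (hpA (f₁.comp (embL e)) (f₂.comp (embR e)) a).symm
  have key2 : ∀ e : A ↪[L₁.sum L₂] B, χ ((pB f₁ f₂).comp e) =
      χ (pA (f₁.comp (embL g₀)) (f₂.comp (embR g₀))) := by
    intro e
    rw [key]
    have h := eqv.injective (hf₁ (embL e) (embL g₀))
    exact (congrFun h _).trans (hf₂ (embR e) (embR g₀))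
  intro e₁ e₂
  exact (key2 e₁).trans (key2 e₂).symm
end

section
/- Let τ be a relational signature. For all finite (τ ∪ {≤})-structures A and B in which ≤ denotes a linear order, and every r ∈ ℕ, there exists a finite (τ ∪ {≤})-structure C in which ≤ denotes a linear order such that C → (B)^A_r. Hence the class of all finite linearly ordered τ-structures is a Ramsey class. -/
open FirstOrder FirstOrder.Language

universe u v w

/-- A finite linearly ordered `τ`-structure. -/
structure OrdStruct (L : FirstOrder.Language.{u, v}) where
  carrier : Type w
  str : L.Structure carrier
  fin : Finite carrier
  lt : carrier → carrier → Prop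
  linear : IsStrictTotalOrder carrier lt

attribute [instance] OrdStruct.str

/-- Embeddings of linearly ordered `τ`-structures: `τ`-embeddings preserving the order in
both directions. -/
def OEmb {L : FirstOrder.Language.{u, v}} (A B : OrdStruct.{u, v, w} L) : Type _ :=
  {f : A.carrier ↪[L] B.carrier // ∀ x y, B.lt (f x) (f y) ↔ A.lt x y}

/-- Composition of embeddings of ordered structures. -/
def OEmb.comp {L : FirstOrder.Language.{u, v}} {A B C : OrdStruct.{u, v, w} L}
    (g : OEmb B C) (f : OEmb A B) : OEmb A C :=
  ⟨g.1.comp f.1, fun x y => by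
    rw [Embedding.comp_apply, Embedding.comp_apply, g.2, f.2]⟩

theorem endHomog {κ : Type} (k : ℕ)
    (hk : ∀ m : ℕ, ∃ n : ℕ, ∀ (N : Type) (_ : LinearOrder N) (T : Finset N), n ≤ T.card →
      ∀ c : Finset N → κ, ∃ H ⊆ T, H.card = m ∧
        ∃ d, ∀ s ⊆ H, s.card = k → c s = d) (m : ℕ) :
    ∃ n : ℕ, ∀ (N : Type) (_ : LinearOrder N) (T : Finset N), n ≤ T.card →
      ∀ c : Finset N → κ, ∃ H ⊆ T, H.card = m ∧ ∃ d : N → κ,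
        ∀ x ∈ H, ∀ s ⊆ H, (∀ y ∈ s, x < y) → s.card = k → c (insert x s) = d x := by
  induction m with
  | zero =>
    refine ⟨0, fun N _ T _ c => ⟨∅, by simp, by simp, fun x => c {x}, by simp⟩⟩
  | succ m ih =>
    obtain ⟨n, hn⟩ := ih
    obtain ⟨n', hn'⟩ := hk n
    refine ⟨n' + 1, fun N _ T hT c => ?_⟩
    have hne : T.Nonempty := by
      rw [← Finset.card_pos]; omega
    set x := T.min' hne with hx
    have hxT : x ∈ T := T.min'_mem hne
    obtain ⟨T', hT'sub, hT'card, d0, hd0⟩ := hn' N ‹_› (T.erase x)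
      (by rw [Finset.card_erase_of_mem hxT]; omega) (fun s => c (insert x s))
    obtain ⟨H, hH, hHc, d, hd⟩ := hn N ‹_› T' hT'card.ge c
    have hlt : ∀ y ∈ H, x < y := by
      intro y hy
      have := hT'sub (hH hy)
      rw [Finset.mem_erase] at this
      exact lt_of_le_of_ne (T.min'_le y this.2) (Ne.symm this.1)
    have hxH : x ∉ H := fun h => lt_irrefl _ (hlt x h)
    refine ⟨insert x H, ?_, by rw [Finset.card_insert_of_notMem hxH, hHc],
      Function.update d x d0, ?_⟩
    · intro y hy
      rcases Finset.mem_insert.1 hy with rfl | hy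
      · exact hxT
      · exact (Finset.mem_erase.1 (hT'sub (hH hy))).2
    · intro z hz s hs hzs hsc
      have hxs : x ∉ s := by
        intro h
        have h1 := hzs x h
        rcases Finset.mem_insert.1 hz with rfl | hz
        · exact lt_irrefl _ h1
        · exact lt_asymm h1 (hlt z hz)
      have hsH : s ⊆ H := by
        intro y hy
        rcases Finset.mem_insert.1 (hs hy) with rfl | h
        · exact absurd hy hxs
        · exact h
      by_cases hzx : z = x
      · subst hzx
        rw [Function.update_self]
        exact hd0 s (hsH.trans hH) hsc
      · rw [Function.update_of_ne hzx]
        exact hd z (Finset.mem_of_mem_insert_of_ne hz hzx) s hsH hzs hsc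

theorem finRamsey {κ : Type} [Finite κ] [Nonempty κ] (k : ℕ) :
    ∀ m : ℕ, ∃ n : ℕ, ∀ (N : Type) (_ : LinearOrder N) (T : Finset N), n ≤ T.card →
      ∀ c : Finset N → κ, ∃ H ⊆ T, H.card = m ∧
        ∃ d, ∀ s ⊆ H, s.card = k → c s = d := by
  classical
  induction k with
  | zero =>
    intro m
    refine ⟨m, fun N _ T hT c => ?_⟩
    obtain ⟨H, h1, h2⟩ := Finset.exists_subset_card_eq hT
    refine ⟨H, h1, h2, c ∅, ?_⟩
    intro s _ hs
    rw [Finset.card_eq_zero.1 hs]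
  | succ k ih =>
    intro m
    have := Fintype.ofFinite κ
    obtain ⟨n, hn⟩ := endHomog k ih (Fintype.card κ * m)
    refine ⟨n, fun N _ T hT c => ?_⟩
    obtain ⟨H, hH, hHc, d, hd⟩ := hn N ‹_› T hT c
    obtain ⟨y, -, hy⟩ := Finset.exists_le_card_fiber_of_mul_le_card_of_maps_to
      (s := H) (t := (Finset.univ : Finset κ)) (f := d) (n := m)
      (fun _ _ => Finset.mem_univ _) Finset.univ_nonempty (by rw [hHc, Finset.card_univ])
    obtain ⟨H', h1, h2⟩ := Finset.exists_subset_card_eq hy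
    have hH' : H' ⊆ H := fun x hx => (Finset.mem_filter.1 (h1 hx)).1
    refine ⟨H', hH'.trans hH, h2, y, ?_⟩
    intro s hs hsc
    have hne : s.Nonempty := by rw [← Finset.card_pos]; omega
    have hm := s.min'_mem hne
    have := hd (s.min' hne) (hH' (hs hm)) (s.erase (s.min' hne))
      ((Finset.erase_subset _ _).trans (hs.trans hH'))
      (fun z hz => s.min'_lt_of_mem_erase_min' hne hz)
      (by rw [Finset.card_erase_of_mem hm]; omega)
    rw [Finset.insert_erase hm] at this
    rw [this]
    exact (Finset.mem_filter.1 (h1 (hs hm))).2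

theorem ordRamsey {κ : Type} [Finite κ] [Nonempty κ] (A B : Type w) [LinearOrder A] [LinearOrder B]
    [Finite A] [Finite B] : ∃ n : ℕ, ∀ c : (A → Fin n) → κ, ∃ β : B → Fin n, StrictMono β ∧
      ∃ d, ∀ e : A → B, StrictMono e → c (β ∘ e) = d := by
  classical
  have := Fintype.ofFinite A
  have := Fintype.ofFinite B
  obtain ⟨n, hn⟩ := finRamsey (κ := κ) (Fintype.card A) (Fintype.card B)
  refine ⟨n, fun c => ?_⟩
  obtain ⟨H, -, hHc, d, hd⟩ := hn (Fin n) inferInstance Finset.univ (by simp)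
    (fun s => if h : ∃ α : A → Fin n, StrictMono α ∧ Finset.univ.image α = s then
      c h.choose else Classical.arbitrary κ)
  let i := Fintype.orderIsoFinOfCardEq B rfl
  have hβ : StrictMono (fun b => H.orderEmbOfFin hHc (i.symm b)) :=
    (H.orderEmbOfFin hHc).strictMono.comp i.symm.strictMono
  refine ⟨_, hβ, d, ?_⟩
  intro e he
  have hmono := hβ.comp he
  have := hd (Finset.univ.image ((fun b => H.orderEmbOfFin hHc (i.symm b)) ∘ e))
    (by
      intro y hy
      obtain ⟨x, -, rfl⟩ := Finset.mem_image.1 hy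
      exact H.orderEmbOfFin_mem hHc _)
    (by rw [Finset.card_image_of_injective _ hmono.injective, Finset.card_univ])
  have hex : ∃ α : A → Fin n, StrictMono α ∧
    Finset.univ.image α = Finset.univ.image ((fun b => H.orderEmbOfFin hHc (i.symm b)) ∘ e) :=
    ⟨_, hmono, rfl⟩
  rw [dif_pos hex] at this
  rw [← this]
  congr 1
  have h2 := hex.choose_spec
  refine ((StrictMono.range_inj h2.1 hmono).1 ?_).symm
  have := congrArg (fun s : Finset (Fin n) => (s : Set (Fin n))) h2.2
  simpa [Function.comp_def] using this

/-- auxiliary power structure -/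
def powS {L : FirstOrder.Language.{u, v}} [L.IsRelational] {A V : Type w} [L.Structure A]
    [L.Structure V] {N ι : Type} (α : A → N) : L.Structure (N × (ι → Option V)) where
  funMap := fun f => isEmptyElim f
  RelMap := fun {k} R u =>
    ((∃ a : Fin k → A, (∀ j, α (a j) = (u j).1) ∧ Structure.RelMap R a) ∧
      ∀ i, ∃ v : Fin k → V, Structure.RelMap R v ∧ ∀ j, (u j).2 i = some (v j)) ∨
    ((¬ ∃ a : Fin k → A, (∀ j, α (a j) = (u j).1) ∧ Structure.RelMap R a) ∧
      ∃ i, ∃ v : Fin k → V, Structure.RelMap R v ∧ ∀ j, (u j).2 i = some (v j))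

theorem partiteStep {L : FirstOrder.Language.{u, v}} [L.IsRelational] {κ : Type} [Finite κ]
    [Nonempty κ] {A V : Type w} [L.Structure A] [L.Structure V] [Finite A] [Finite V] {N : Type} [Finite N]
    (π : V → N) (α : A → N) (hα : Function.Injective α) :
    ∃ (V' : Type w) (_ : Finite V') (_ : L.Structure V') (π' : V' → N),
      ∀ χ : (A ↪[L] V') → κ, ∃ f : V ↪[L] V', (∀ x, π' (f x) = π x) ∧
        ∃ d, ∀ e : A ↪[L] V, (∀ a, π (e a) = α a) → χ (f.comp e) = d := by
  classical
  by_cases hX : Nonempty {e : A ↪[L] V // ∀ a, π (e a) = α a}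
  swap
  · refine ⟨V, inferInstance, inferInstance, π, fun χ => ⟨Embedding.refl L V, fun _ => rfl, ?_⟩⟩
    exact ⟨Classical.arbitrary κ, fun e he => absurd ⟨⟨e, he⟩⟩ hX⟩
  have hfin : Finite {e : A ↪[L] V // ∀ a, π (e a) = α a} :=
    Finite.of_injective (fun e => (e.1 : A → V)) (fun e e' h =>
      Subtype.ext (DFunLike.coe_injective h))
  obtain ⟨ι, _, hι⟩ := Combinatorics.Line.exists_mono_in_high_dimension
    {e : A ↪[L] V // ∀ a, π (e a) = α a} κ
  letI S : L.Structure (N × (ι → Option V)) := powS (A := A) α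
  refine ⟨N × (ι → Option V), inferInstance, S, Prod.fst, fun χ => ?_⟩
  let word : (ι → {e : A ↪[L] V // ∀ a, π (e a) = α a}) → (A ↪[L] (N × (ι → Option V))) :=
    fun w =>
    { toFun := fun a => (α a, fun i => some ((w i).1 a))
      inj' := fun a b h => hα (congrArg Prod.fst h)
      map_fun' := fun f => isEmptyElim f
      map_rel' := by
        intro k R a
        have key : (∃ a' : Fin k → A, (∀ j, α (a' j) = α (a j)) ∧ Structure.RelMap R a') ↔
            Structure.RelMap R a := by
          constructor
          · rintro ⟨a', h1, h2⟩
            have : a' = a := funext fun j => hα (h1 j)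
            rwa [← this]
          · exact fun h => ⟨a, fun _ => rfl, h⟩
        have hS : ∀ i, (∃ v : Fin k → V, Structure.RelMap R v ∧
            ∀ j, some ((w i).1 (a j)) = some (v j)) ↔ Structure.RelMap R a := by
          intro i
          rw [← (w i).1.map_rel R a]
          constructor
          · rintro ⟨v, h1, h2⟩
            have : v = (w i).1 ∘ a := funext fun j => (Option.some_injective _ (h2 j)).symm
            rwa [← this]
          · exact fun h => ⟨_, h, fun _ => rfl⟩
        change (((∃ a' : Fin k → A, (∀ j, α (a' j) = α (a j)) ∧ Structure.RelMap R a') ∧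
          ∀ i, (∃ v : Fin k → V, Structure.RelMap R v ∧
            ∀ j, some ((w i).1 (a j)) = some (v j))) ∨ 
            ((¬ ∃ a' : Fin k → A, (∀ j, α (a' j) = α (a j)) ∧ Structure.RelMap R a') ∧
          ∃ i, (∃ v : Fin k → V, Structure.RelMap R v ∧
            ∀ j, some ((w i).1 (a j)) = some (v j)))) ↔ _
        simp only [key, hS]
        constructor
        · rintro (h | ⟨h, i, h'⟩)
          · exact h.1
          · exact h'
        · exact fun h => Or.inl ⟨h, fun _ => h⟩ }
  obtain ⟨l, d, hl⟩ := hι (fun w => χ (word w))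
  obtain ⟨i₀, hi₀⟩ := l.proper
  let F : V → ι → Option V := fun v i =>
    match l.idxFun i with
    | none => some v
    | some x => if h : ∃ a, α a = π v then some (x.1 h.choose) else none
  have Fnone : ∀ v i, l.idxFun i = none → F v i = some v := by
    intro v i h; simp only [F, h]
  have Fsome : ∀ v i x a, l.idxFun i = some x → α a = π v → F v i = some (x.1 a) := by
    intro v i x a h ha
    have hex : ∃ a, α a = π v := ⟨a, ha⟩
    simp only [F, h, dif_pos hex]
    rw [hα (hex.choose_spec.trans ha.symm)]
  have Fsome' : ∀ v i x y, l.idxFun i = some x → F v i = some y → ∃ a, α a = π v ∧ x.1 a = y := by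
    intro v i x y h hy
    by_cases hex : ∃ a, α a = π v
    · obtain ⟨a, ha⟩ := hex
      rw [Fsome v i x a h ha] at hy
      exact ⟨a, ha, Option.some_injective _ hy⟩
    · simp only [F, h, dif_neg hex] at hy
      cases hy
  let f : V ↪[L] (N × (ι → Option V)) :=
    { toFun := fun v => (π v, F v)
      inj' := by
        intro v v' h
        have h1 := congrFun (congrArg Prod.snd h) i₀
        simp only [Fnone _ _ hi₀] at h1
        exact Option.some_injective _ h1
      map_fun' := fun f => isEmptyElim f
      map_rel' := by
        intro k R v
        change (((∃ a' : Fin k → A, (∀ j, α (a' j) = π (v j)) ∧ Structure.RelMap R a') ∧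
          ∀ i, (∃ v' : Fin k → V, Structure.RelMap R v' ∧
            ∀ j, F (v j) i = some (v' j))) ∨ 
            ((¬ ∃ a' : Fin k → A, (∀ j, α (a' j) = π (v j)) ∧ Structure.RelMap R a') ∧
          ∃ i, (∃ v' : Fin k → V, Structure.RelMap R v' ∧
            ∀ j, F (v j) i = some (v' j)))) ↔ _
        have hact : ∀ i, l.idxFun i = none → ((∃ v' : Fin k → V, Structure.RelMap R v' ∧
            ∀ j, F (v j) i = some (v' j)) ↔ Structure.RelMap R v) := by
          intro i hi
          constructor
          · rintro ⟨v', h1, h2⟩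
            have : v' = v := funext fun j => by
              have := h2 j
              rw [Fnone _ _ hi] at this
              exact (Option.some_injective _ this).symm
            rwa [← this]
          · exact fun h => ⟨v, h, fun j => Fnone _ _ hi⟩
        constructor
        · rintro (⟨-, h⟩ | ⟨h, i, h'⟩)
          · exact (hact i₀ hi₀).1 (h i₀)
          · cases hi : l.idxFun i with
            | none => exact (hact i hi).1 h'
            | some x =>
              exfalso
              obtain ⟨v', h1, h2⟩ := h'
              choose a ha hxa using fun j => Fsome' (v j) i x (v' j) hi (h2 j)
              refine h ⟨a, ha, ?_⟩
              rw [← x.1.map_rel R a]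
              have : x.1 ∘ a = v' := funext hxa
              rwa [this]
        · intro h
          by_cases hs : ∃ a' : Fin k → A, (∀ j, α (a' j) = π (v j)) ∧ Structure.RelMap R a'
          · refine Or.inl ⟨hs, fun i => ?_⟩
            cases hi : l.idxFun i with
            | none => exact (hact i hi).2 h
            | some x =>
              obtain ⟨a, ha, hR⟩ := hs
              exact ⟨x.1 ∘ a, (x.1.map_rel R a).2 hR, fun j => Fsome _ _ _ _ hi (ha j)⟩
          · exact Or.inr ⟨hs, i₀, (hact i₀ hi₀).2 h⟩ }
  refine ⟨f, fun _ => rfl, d, fun e he => ?_⟩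
  rw [← hl ⟨e, he⟩]
  congr 1
  refine DFunLike.ext _ _ (fun a => ?_)
  change (π (e a), F (e a)) = (α a, fun i => some ((l ⟨e, he⟩ i).1 a))
  refine Prod.ext (he a) (funext fun i => ?_)
  change F (e a) i = some ((l ⟨e, he⟩ i).1 a)
  cases hi : l.idxFun i with
  | none => rw [Fnone _ _ hi, Combinatorics.Line.apply_none _ _ _ hi]
  | some x =>
    rw [Fsome _ _ _ a hi (he a).symm, Combinatorics.Line.apply_some hi]

theorem partiteAll {L : FirstOrder.Language.{u, v}} [L.IsRelational] {κ : Type} [Finite κ]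
    [Nonempty κ]
    {A V : Type w} [L.Structure A] [L.Structure V] [Finite A] [Finite V] {N : Type} [Finite N]
    (π : V → N) (S : Finset (A → N)) (hS : ∀ α ∈ S, Function.Injective α) :
    ∃ (V' : Type w) (_ : Finite V') (_ : L.Structure V') (π' : V' → N),
      ∀ χ : (A ↪[L] V') → κ, ∃ f : V ↪[L] V', (∀ x, π' (f x) = π x) ∧
        ∀ α ∈ S, ∃ d, ∀ e : A ↪[L] V, (∀ a, π (e a) = α a) → χ (f.comp e) = d := by
  classical
  induction S using Finset.induction_on with
  | empty =>
    exact ⟨V, inferInstance, inferInstance, π, fun χ => ⟨Embedding.refl L V, fun _ => rfl, by simp⟩⟩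
  | insert α S _ ih =>
    obtain ⟨V₁, _, _, π₁, h₁⟩ := ih (fun β hβ => hS β (Finset.mem_insert_of_mem hβ))
    obtain ⟨V₂, i₂, s₂, π₂, h₂⟩ := partiteStep (L := L) (κ := κ) π₁ α
      (hS α (Finset.mem_insert_self _ _))
    refine ⟨V₂, i₂, s₂, π₂, fun χ => ?_⟩
    obtain ⟨g, hg, d, hd⟩ := h₂ χ
    obtain ⟨f, hf, hfd⟩ := h₁ (fun e => χ (g.comp e))
    refine ⟨g.comp f, fun x => by rw [Embedding.comp_apply, hg, hf], ?_⟩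
    intro β hβ
    rcases Finset.mem_insert.1 hβ with rfl | hβ
    · refine ⟨d, fun e he => ?_⟩
      rw [Embedding.comp_assoc]
      exact hd (f.comp e) (fun a => by rw [Embedding.comp_apply, hf, he])
    · obtain ⟨d', hd'⟩ := hfd β hβ
      refine ⟨d', fun e he => ?_⟩
      rw [Embedding.comp_assoc]
      exact hd' e he

/-- disjoint copies -/
def copS {L : FirstOrder.Language.{u, v}} [L.IsRelational] {B : Type w} [L.Structure B]
    (I : Type w) : L.Structure (I × B) where
  funMap := fun f => isEmptyElim f
  RelMap := fun {k} R u => ∃ i, ∃ b : Fin k → B, Structure.RelMap R b ∧ ∀ j, u j = (i, b j)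

/-- (Nešetřil–Rödl, Abramson–Harrington.)  For every relational signature `τ`, the class of
all finite linearly ordered `τ`-structures is a Ramsey class: for all finite ordered
`τ`-structures `A`, `B` and every `r` there is a finite ordered `τ`-structure `C` with
`C → (B)^A_r`. -/
theorem stmt13 (L : FirstOrder.Language.{u, v}) [L.IsRelational]
    (A B : OrdStruct.{u, v, w} L) (r : ℕ) :
    ∃ C : OrdStruct.{u, v, w} L,
      ∀ χ : OEmb A C → Fin r, ∃ f : OEmb B C,
        ∀ e₁ e₂ : OEmb A B, χ (f.comp e₁) = χ (f.comp e₂) := by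
  classical
  rcases Nat.eq_zero_or_pos r with rfl | hr
  · exact ⟨B, fun χ => ⟨⟨Embedding.refl L _, fun _ _ => Iff.rfl⟩, fun e₁ => (χ (OEmb.comp
      ⟨Embedding.refl L _, fun _ _ => Iff.rfl⟩ e₁)).elim0⟩⟩
  have : Nonempty (Fin r) := ⟨⟨0, hr⟩⟩
  have := A.fin
  have := B.fin
  have := A.linear
  have := B.linear
  letI : LinearOrder A.carrier := linearOrderOfSTO A.lt
  letI : LinearOrder B.carrier := linearOrderOfSTO B.lt
  obtain ⟨n, hn⟩ := ordRamsey (κ := Fin r) A.carrier B.carrier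
  let I : Type w := {β : B.carrier → Fin n // StrictMono β}
  letI : L.Structure (I × B.carrier) := copS I
  let π : I × B.carrier → Fin n := fun x => x.1.1 x.2
  have := Fintype.ofFinite (A.carrier → Fin n)
  obtain ⟨V, _, sV, π', hV⟩ := partiteAll (L := L) (κ := Fin r) (A := A.carrier) π
    (Finset.univ.filter StrictMono) (fun α hα => (Finset.mem_filter.1 hα).2.injective)
  obtain ⟨m, ⟨enc⟩⟩ := Finite.exists_equiv_fin V
  letI lo : LinearOrder V := LinearOrder.lift' (fun x => toLex (π' x, enc x)) (fun x y h =>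
    enc.injective (congrArg Prod.snd (toLex.injective h)))
  have hlt : ∀ x y, π' x < π' y → x < y := by
    intro x y h
    exact Prod.Lex.toLex_lt_toLex.2 (Or.inl h)
  have hA : ∀ e : A.carrier → V, StrictMono (π' ∘ e) → ∀ x y, e x < e y ↔ A.lt x y := by
    intro e he x y
    have : StrictMono e := fun a b h => hlt _ _ (he h)
    exact this.lt_iff_lt
  have hB : ∀ e : B.carrier → V, StrictMono (π' ∘ e) → ∀ x y, e x < e y ↔ B.lt x y := by
    intro e he x y
    have : StrictMono e := fun a b h => hlt _ _ (he h)
    exact this.lt_iff_lt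
  let C : OrdStruct.{u, v, w} L := ⟨V, sV, inferInstance, fun x y => x < y, inferInstance⟩
  refine ⟨C, fun χ => ?_⟩
  let χ' : (A.carrier ↪[L] V) → Fin r := fun e =>
    if h : ∀ x y, e x < e y ↔ A.lt x y then χ ⟨e, h⟩ else ⟨0, hr⟩
  obtain ⟨f, hf, hfd⟩ := hV χ'
  have hex : ∀ α : A.carrier → Fin n, ∃ d : Fin r, StrictMono α →
      ∀ e : A.carrier ↪[L] (I × B.carrier), (∀ a, π (e a) = α a) → χ' (f.comp e) = d := by
    intro α
    by_cases h : StrictMono α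
    · obtain ⟨d, hd⟩ := hfd α (by simp [h])
      exact ⟨d, fun _ => hd⟩
    · exact ⟨⟨0, hr⟩, fun h' => absurd h' h⟩
  choose c hc using hex
  obtain ⟨β, hβ, d, hd⟩ := hn c
  let g : B.carrier ↪[L] (I × B.carrier) :=
    { toFun := fun b => (⟨β, hβ⟩, b)
      inj' := fun x y h => congrArg Prod.snd h
      map_fun' := fun f => isEmptyElim f
      map_rel' := by
        intro k R b
        constructor
        · rintro ⟨i, b', h1, h2⟩
          have : b' = b := funext fun j => (congrArg Prod.snd (h2 j)).symm
          rwa [← this]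
        · exact fun h => ⟨⟨β, hβ⟩, b, h, fun _ => rfl⟩ }
  have hfg : π' ∘ (f.comp g) = β := funext fun b => by
    simp only [Function.comp, Embedding.comp_apply, hf]; rfl
  let F : OEmb B C := ⟨f.comp g, hB _ (by rw [hfg]; exact hβ)⟩
  have main : ∀ e : OEmb A B, χ (F.comp e) = d := by
    intro e
    have he : StrictMono (e.1 : A.carrier → B.carrier) := fun x y h => (e.2 x y).2 h
    rw [← hd _ he, ← hc _ (hβ.comp he) (g.comp e.1) (fun a => rfl)]
    have h : ∀ x y, (f.comp (g.comp e.1)) x < (f.comp (g.comp e.1)) y ↔ A.lt x y :=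
      (F.comp e).2
    simp only [χ', dif_pos h]
    rfl
  exact ⟨F, fun e₁ e₂ => by rw [main, main]⟩
end

section
/- Let τ be a finite relational signature and let ℱ be a set of finite irreducible τ-structures. Let 𝒞 be the class of all finite (τ ∪ {≤})-structures in which ≤ denotes a linear order and whose τ-reduct admits no homomorphism from any member of ℱ. Then for all A, B ∈ 𝒞 and every r ∈ ℕ there exists C ∈ 𝒞 such that C → (B)^A_r; that is, 𝒞 = Forb(ℱ) * LO is a Ramsey class. -/
open FirstOrder FirstOrder.Language CategoryTheory

universe u v w

/-- A structure is irreducible if any two distinct elements appear together in some tuple of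
a relation. -/
def IrreducibleStructure (L : FirstOrder.Language.{u, v}) (F : Bundled.{w} L.Structure) : Prop :=
  ∀ x y : F, x ≠ y → ∃ (k : ℕ) (R : L.Relations k) (t : Fin k → F),
    Structure.RelMap R t ∧ (∃ i, t i = x) ∧ (∃ j, t j = y)

/-- The `τ`-reduct of `A` admits no homomorphism from any member of `ℱ`. -/
def AvoidsHoms (L : FirstOrder.Language.{u, v}) (ℱ : Set (Bundled.{w} L.Structure))
    (A : OrdStruct.{u, v, w} L) : Prop :=
  ∀ F ∈ ℱ, IsEmpty (F →[L] A.carrier)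

/-- Plain-map version of being an embedding. -/
def PEmb (L : FirstOrder.Language.{u, v}) {X Y : Type w} [L.Structure X] [L.Structure Y]
    (f : X → Y) : Prop :=
  Function.Injective f ∧ ∀ (n : ℕ) (R : L.Relations n) (t : Fin n → X),
    Structure.RelMap R (f ∘ t) ↔ Structure.RelMap R t

def PHom (L : FirstOrder.Language.{u, v}) {X Y : Type w} [L.Structure X] [L.Structure Y]
    (f : X → Y) : Prop :=
  ∀ (n : ℕ) (R : L.Relations n) (t : Fin n → X),
    Structure.RelMap R t → Structure.RelMap R (f ∘ t)

def PRefl (L : FirstOrder.Language.{u, v}) {X Y : Type w} [L.Structure X] [L.Structure Y]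
    (f : X → Y) : Prop :=
  ∀ (n : ℕ) (R : L.Relations n) (t : Fin n → X),
    Structure.RelMap R (f ∘ t) → Structure.RelMap R t

theorem PEmb.comp' {L : FirstOrder.Language.{u, v}} {X Y Z : Type w} [L.Structure X]
    [L.Structure Y] [L.Structure Z] {g : Y → Z} {f : X → Y} (hg : PEmb L g) (hf : PEmb L f) :
    PEmb L (g ∘ f) := by
  refine ⟨hg.1.comp hf.1, fun n R t => ?_⟩
  rw [Function.comp_assoc, hg.2, hf.2]

section Step

variable (L : FirstOrder.Language.{u, v}) {A V I : Type w} [L.Structure A] [L.Structure V]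

/-- Transversal copies of `A`. -/
def TrCopy (π : V → I) (α : A → I) : Type w :=
  {h : A → V // PEmb L h ∧ ∀ p, π (h p) = α p}

open Classical in
noncomputable def sbst (π : V → I) (α : A → I) (h : TrCopy L π α) (x : V) : V :=
  if hp : ∃ p, α p = π x then h.1 hp.choose else x

variable {L} {π : V → I} {α : A → I}

theorem sbst_of (hα : Function.Injective α) (h : TrCopy L π α) {x : V} {p : A}
    (hp : α p = π x) : sbst L π α h x = h.1 p := by
  have h' : ∃ p, α p = π x := ⟨p, hp⟩
  rw [sbst, dif_pos h']
  exact congrArg h.1 (hα (h'.choose_spec.trans hp.symm))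

theorem sbst_not (h : TrCopy L π α) {x : V} (hx : ¬ ∃ p, α p = π x) :
    sbst L π α h x = x := by
  rw [sbst, dif_neg hx]

theorem pi_sbst (hα : Function.Injective α) (h : TrCopy L π α) (x : V) :
    π (sbst L π α h x) = π x := by
  by_cases hx : ∃ p, α p = π x
  · obtain ⟨p, hp⟩ := hx
    rw [sbst_of hα h hp, h.2.2, hp]
  · rw [sbst_not h hx]

variable (L π α) in
def Glued (ι : Type) : Type w := Option (Combinatorics.Line (TrCopy L π α) ι) × (ι → V)

open Classical in
noncomputable def glue {ι : Type} (l : Combinatorics.Line (TrCopy L π α) ι) (x : V) :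
    Glued L π α ι :=
  (if ∃ p, α p = π x then none else some l,
    fun n => (l.idxFun n).elim x (fun h => sbst L π α h x))

theorem glue_fst_pos {ι : Type} (l : Combinatorics.Line (TrCopy L π α) ι) {x : V}
    (hx : ∃ p, α p = π x) : (glue l x).1 = none := by
  simp [glue, hx]

theorem glue_fst_neg {ι : Type} (l : Combinatorics.Line (TrCopy L π α) ι) {x : V}
    (hx : ¬ ∃ p, α p = π x) : (glue l x).1 = some l := by
  simp only [glue, if_neg hx]

theorem glue_snd_none {ι : Type} (l : Combinatorics.Line (TrCopy L π α) ι) (x : V) {n : ι}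
    (hn : l.idxFun n = none) : (glue l x).2 n = x := by
  simp [glue, hn]

theorem glue_snd_some {ι : Type} (l : Combinatorics.Line (TrCopy L π α) ι) (x : V) {n : ι}
    {h : TrCopy L π α} (hn : l.idxFun n = some h) : (glue l x).2 n = sbst L π α h x := by
  simp [glue, hn]

theorem glue_inj {ι : Type} (l : Combinatorics.Line (TrCopy L π α) ι) :
    Function.Injective (glue l) := by
  intro x y hxy
  obtain ⟨n, hn⟩ := l.proper
  rw [← glue_snd_none l x hn, hxy, glue_snd_none l y hn]

theorem pi_glue (hα : Function.Injective α) {ι : Type}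
    (l : Combinatorics.Line (TrCopy L π α) ι) (x : V) (n : ι) :
    π ((glue l x).2 n) = π x := by
  rcases hn : l.idxFun n with _ | h
  · rw [glue_snd_none l x hn]
  · rw [glue_snd_some l x hn, pi_sbst hα h x]

instance gluedStr [L.IsRelational] (ι : Type) : L.Structure (Glued L π α ι) where
  funMap f := isEmptyElim f
  RelMap {_} R s := ∃ (l : Combinatorics.Line (TrCopy L π α) ι) (t : _ → V),
    s = glue l ∘ t ∧ Structure.RelMap R t

theorem glue_emb [L.IsRelational] (hα : Function.Injective α) {ι : Type}
    (l : Combinatorics.Line (TrCopy L π α) ι) : PEmb L (glue l) := by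
  refine ⟨glue_inj l, fun k R t => ⟨?_, fun h => ⟨l, t, rfl, h⟩⟩⟩
  rintro ⟨l', t', htt, ht'⟩
  have htt : ∀ j, glue l (t j) = glue l' (t' j) := fun j => congrFun htt j
  by_cases hD : ∀ j, ∃ p, α p = π (t j)
  · obtain ⟨n, hn⟩ := l.proper
    obtain ⟨m, hm⟩ := l'.proper
    have e1 : ∀ j, t j = (glue l' (t' j)).2 n := fun j => by
      rw [← htt, glue_snd_none l _ hn]
    have e2 : ∀ j, t' j = (glue l (t j)).2 m := fun j => by
      rw [htt, glue_snd_none l' _ hm]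
    rcases hn' : l'.idxFun n with _ | h
    · have : t = t' := funext fun j => by rw [e1, glue_snd_none l' _ hn']
      rwa [this]
    rcases hm' : l.idxFun m with _ | h'
    · have : t = t' := funext fun j => by rw [e2, glue_snd_none l _ hm']
      rwa [this]
    choose p hp using hD
    have e3 : t' = h'.1 ∘ p := funext fun j => by
      rw [e2, glue_snd_some l _ hm', sbst_of hα h' (hp j)]; rfl
    have e4 : t = h.1 ∘ p := funext fun j => by
      rw [e1, glue_snd_some l' _ hn', sbst_of hα h (p := p j)]
      · rfl
      · rw [e3]; exact (h'.2.2 _).symm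
    rw [e4, h.2.1.2]
    rwa [e3, h'.2.1.2] at ht'
  · push Not at hD
    obtain ⟨j, hj⟩ := hD
    have hj' : ¬ ∃ p, α p = π (t j) := fun ⟨p, hp⟩ => hj p hp
    have h1 := congrArg Prod.fst (htt j)
    rw [glue_fst_neg l hj'] at h1
    have h2 : ¬ ∃ p, α p = π (t' j) := fun h => by
      rw [glue_fst_pos l' h] at h1; cases h1
    rw [glue_fst_neg l' h2] at h1
    cases h1
    have : t = t' := funext fun j => glue_inj l (htt j)
    rwa [this]

theorem glue_avoid [L.IsRelational] [L.Structure I] (hα : Function.Injective α) {ι : Type}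
    [Nonempty ι] (hπ : PHom L π) (hr : PRefl L α) (F : Bundled.{w} L.Structure)
    (hF : IrreducibleStructure L F) (g : F →[L] Glued L π α ι) : Nonempty (F →[L] V) := by
  -- good relations
  have good : ∀ (k : ℕ) (R : L.Relations k) (t : Fin k → V)
      (l : Combinatorics.Line (TrCopy L π α) ι) (n : ι), Structure.RelMap R t →
      (∀ j, ∃ p, α p = π (t j)) → Structure.RelMap R (fun j => (glue l (t j)).2 n) := by
    intro k R t l n ht hD
    rcases hn : l.idxFun n with _ | h
    · simpa only [glue_snd_none l _ hn] using ht
    · choose p hp using hD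
      have e : (fun j => (glue l (t j)).2 n) = h.1 ∘ p := funext fun j => by
        rw [glue_snd_some l _ hn, sbst_of hα h (hp j)]; rfl
      rw [e, h.2.1.2]
      apply hr
      have : α ∘ p = π ∘ t := funext hp
      rw [this]
      exact hπ _ _ _ ht
  suffices H : ∃ n : ι, ∀ (k : ℕ) (R : L.Relations k) (s : Fin k → F), Structure.RelMap R s →
      Structure.RelMap R (fun j => (g (s j)).2 n) by
    obtain ⟨n, hn⟩ := H
    exact ⟨⟨fun x => (g x).2 n, fun f => isEmptyElim f, fun R s h => hn _ R s h⟩⟩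
  by_cases hx : ∃ x l, (g x).1 = some l
  · obtain ⟨x, l, hxl⟩ := hx
    obtain ⟨n, hn⟩ := l.proper
    have hy : ∀ y, (g y).1 = none ∨ (g y).1 = some l := by
      intro y
      by_cases hxy : x = y
      · subst hxy; exact Or.inr hxl
      obtain ⟨k, R, s, hs, ⟨i, hi⟩, ⟨j, hj⟩⟩ := hF x y hxy
      obtain ⟨l', t', e, -⟩ := g.map_rel R s hs
      have ei : g (s i) = glue l' (t' i) := congrFun e i
      have ej : g (s j) = glue l' (t' j) := congrFun e j
      rw [hi] at ei; rw [hj] at ej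
      rw [ei] at hxl
      have hl : l' = l := by
        by_cases h : ∃ p, α p = π (t' i)
        · rw [glue_fst_pos l' h] at hxl; cases hxl
        · rw [glue_fst_neg l' h] at hxl; cases hxl; rfl
      subst hl
      rw [ej]
      by_cases h : ∃ p, α p = π (t' j)
      · exact Or.inl (glue_fst_pos l' h)
      · exact Or.inr (glue_fst_neg l' h)
    refine ⟨n, fun k R s hs => ?_⟩
    obtain ⟨l', t', e, ht'⟩ := g.map_rel R s hs
    have e : ∀ j, g (s j) = glue l' (t' j) := fun j => congrFun e j
    simp only [e]
    by_cases hD : ∀ j, ∃ p, α p = π (t' j)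
    · exact good _ _ _ _ _ ht' hD
    · rw [not_forall] at hD
      obtain ⟨j, hj⟩ := hD
      have h1 := hy (s j)
      rw [e, glue_fst_neg l' hj] at h1
      rcases h1 with h1 | h1
      · cases h1
      · cases h1
        simpa only [glue_snd_none l _ hn] using ht'
  · obtain ⟨n⟩ := ‹Nonempty ι›
    refine ⟨n, fun k R s hs => ?_⟩
    obtain ⟨l', t', e, ht'⟩ := g.map_rel R s hs
    have e : ∀ j, g (s j) = glue l' (t' j) := fun j => congrFun e j
    simp only [e]
    refine good _ _ _ _ _ ht' fun j => ?_
    by_contra hj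
    exact hx ⟨s j, l', by rw [e, glue_fst_neg l' hj]⟩

end Step

theorem partite_step (L : FirstOrder.Language.{u, v}) [L.IsRelational] {A V I : Type w}
    [L.Structure A] [L.Structure V] [L.Structure I] [Finite A] [Finite V] (π : V → I)
    (α : A → I) (hα : Function.Injective α) (r : ℕ) :
    ∃ (V' : Type w) (_ : L.Structure V') (_ : Finite V') (π' : V' → I),
      (∀ χ : (A → V') → Fin (r + 1), ∃ l : V → V', PEmb L l ∧ (∀ x, π' (l x) = π x) ∧
        ∀ h₁ h₂ : A → V, PEmb L h₁ → (∀ p, π (h₁ p) = α p) → PEmb L h₂ →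
          (∀ p, π (h₂ p) = α p) → χ (l ∘ h₁) = χ (l ∘ h₂)) ∧
      (PHom L π → PRefl L α → PHom L π' ∧ ∀ F : Bundled.{w} L.Structure,
        IrreducibleStructure L F → Nonempty (F →[L] V') → Nonempty (F →[L] V)) := by
  have : Finite (TrCopy L π α) := by unfold TrCopy; infer_instance
  obtain ⟨ι, _, hι⟩ := Combinatorics.Line.exists_mono_in_high_dimension (TrCopy L π α)
    (Fin (r + 1))
  obtain ⟨l₀, -⟩ := hι fun _ => 0
  obtain ⟨n₀, -⟩ := l₀.proper
  have : Nonempty ι := ⟨n₀⟩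
  have : Finite (Combinatorics.Line (TrCopy L π α) ι) :=
    Finite.of_injective (fun l => l.idxFun) fun a b h => Combinatorics.Line.ext h
  have : Finite (Glued L π α ι) := by unfold Glued; infer_instance
  refine ⟨Glued L π α ι, inferInstance, inferInstance, fun x => π (x.2 n₀), ?_, ?_⟩
  · intro χ
    obtain ⟨l, c, hl⟩ := hι fun wd => χ fun p => (none, fun n => (wd n).1 p)
    refine ⟨glue l, glue_emb hα l, fun x => pi_glue hα l x n₀, ?_⟩
    have key : ∀ h : A → V, PEmb L h → (∀ p, π (h p) = α p) → χ (glue l ∘ h) = c := by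
      intro h h1 h2
      rw [← hl ⟨h, h1, h2⟩]
      congr 1
      funext p
      refine Prod.ext (glue_fst_pos l ⟨p, (h2 p).symm⟩) (funext fun n => ?_)
      show (glue l (h p)).2 n = ((l.idxFun n).getD ⟨h, h1, h2⟩).1 p
      rcases hn : l.idxFun n with _ | h'
      · rw [glue_snd_none l _ hn]; rfl
      · rw [glue_snd_some l _ hn, sbst_of hα h' (h2 p).symm]; rfl
    intro h₁ h₂ a b c d
    rw [key h₁ a b, key h₂ c d]
  · intro hπ hr
    refine ⟨?_, fun F hF ⟨g⟩ => glue_avoid hα hπ hr F hF g⟩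
    rintro k R s ⟨l, t, rfl, ht⟩
    have : (fun x : Glued L π α ι => π (x.2 n₀)) ∘ glue l ∘ t = π ∘ t :=
      funext fun j => pi_glue hα l (t j) n₀
    rw [this]
    exact hπ _ _ _ ht

theorem partite_list (L : FirstOrder.Language.{u, v}) [L.IsRelational] {A I : Type w}
    [L.Structure A] [L.Structure I] [Finite A] (r : ℕ) (as : List (A → I))
    (has : ∀ α ∈ as, Function.Injective α) :
    ∀ (V : Type w) [L.Structure V] [Finite V] (π : V → I),
    ∃ (V' : Type w) (_ : L.Structure V') (_ : Finite V') (π' : V' → I),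
      (∀ χ : (A → V') → Fin (r + 1), ∃ l : V → V', PEmb L l ∧ (∀ x, π' (l x) = π x) ∧
        ∀ α ∈ as, ∀ h₁ h₂ : A → V, PEmb L h₁ → (∀ p, π (h₁ p) = α p) → PEmb L h₂ →
          (∀ p, π (h₂ p) = α p) → χ (l ∘ h₁) = χ (l ∘ h₂)) ∧
      (PHom L π → (∀ α ∈ as, PRefl L α) → PHom L π' ∧ ∀ F : Bundled.{w} L.Structure,
        IrreducibleStructure L F → Nonempty (F →[L] V') → Nonempty (F →[L] V)) := by
  induction as with
  | nil =>
    intro V _ _ π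
    refine ⟨V, inferInstance, inferInstance, π, fun χ => ⟨id, ⟨Function.injective_id, ?_⟩,
      fun _ => rfl, by simp⟩, fun h _ => ⟨h, fun F _ h => h⟩⟩
    intro n R t; rfl
  | cons α as ih =>
    intro V _ _ π
    obtain ⟨V₁, i1, i2, π₁, h1, h1'⟩ := partite_step L π α (has α (by simp)) r
    obtain ⟨V₂, i3, i4, π₂, h2, h2'⟩ := ih (fun β hβ => has β (by simp [hβ])) V₁ π₁
    refine ⟨V₂, i3, i4, π₂, ?_, ?_⟩
    · intro χ
      obtain ⟨m, hm, hmπ, hmχ⟩ := h2 χ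
      obtain ⟨l, hl, hlπ, hlχ⟩ := h1 fun h => χ (m ∘ h)
      refine ⟨m ∘ l, hm.comp' hl, fun x => by simp [hmπ, hlπ], ?_⟩
      intro β hβ k₁ k₂ a b c d
      rcases List.mem_cons.1 hβ with rfl | hβ
      · exact hlχ k₁ k₂ a b c d
      · exact hmχ β hβ (l ∘ k₁) (l ∘ k₂) (hl.comp' a) (fun p => by simp [hlπ, b])
          (hl.comp' c) (fun p => by simp [hlπ, d])
    · intro hπ hr
      obtain ⟨a, b⟩ := h1' hπ (hr α (by simp))
      obtain ⟨c, d⟩ := h2' a (fun β hβ => hr β (by simp [hβ]))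
      exact ⟨c, fun F hF h => b F hF (d F hF h)⟩

theorem strictMap_inj {X Y : Type w} {r : X → X → Prop} {s : Y → Y → Prop}
    (hr : IsStrictTotalOrder X r) (hs : IsStrictTotalOrder Y s) {f : X → Y}
    (hf : ∀ x y, s (f x) (f y) ↔ r x y) : Function.Injective f := by
  intro x y hxy
  rcases trichotomous_of r x y with h | h | h
  · have := (hf x y).2 h
    rw [hxy] at this
    exact absurd this (irrefl_of s _)
  · exact h
  · have := (hf y x).2 h
    rw [hxy] at this
    exact absurd this (irrefl_of s _)

def PEmb.toEmb {L : FirstOrder.Language.{u, v}} [L.IsRelational] {X Y : Type w} [L.Structure X]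
    [L.Structure Y] {f : X → Y} (hf : PEmb L f) : X ↪[L] Y where
  toFun := f
  inj' := hf.1
  map_fun' g := isEmptyElim g
  map_rel' R t := hf.2 _ R t

theorem OEmb.pemb {L : FirstOrder.Language.{u, v}} {A B : OrdStruct.{u, v, w} L}
    (e : OEmb A B) : PEmb L (e.1 : A.carrier → B.carrier) :=
  ⟨e.1.injective, fun _ R t => e.1.map_rel R t⟩

/-- Disjoint copies of `B`. -/
def Copies (L : FirstOrder.Language.{u, v}) (B : OrdStruct.{u, v, w} L) {I : Type w}
    (ℬ : Set (B.carrier → I)) : Type w := ℬ × B.carrier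

instance copiesStr (L : FirstOrder.Language.{u, v}) [L.IsRelational] (B : OrdStruct.{u, v, w} L)
    {I : Type w} (ℬ : Set (B.carrier → I)) : L.Structure (Copies L B ℬ) where
  funMap f := isEmptyElim f
  RelMap {_} R s := ∃ (β : ℬ) (t : _ → B.carrier), s = (fun b => (β, b)) ∘ t ∧
    Structure.RelMap R t

theorem partite_main (L : FirstOrder.Language.{u, v}) [L.IsRelational]
    (A B C₀ : OrdStruct.{u, v, w} L) (r : ℕ)
    (𝒜 : Set (A.carrier → C₀.carrier)) (ℬ : Set (B.carrier → C₀.carrier))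
    (h𝒜 : ∀ α ∈ 𝒜, ∀ x y, C₀.lt (α x) (α y) ↔ A.lt x y)
    (hℬ : ∀ β ∈ ℬ, ∀ x y, C₀.lt (β x) (β y) ↔ B.lt x y)
    (hcomp : ∀ β ∈ ℬ, ∀ e : OEmb A B, β ∘ e.1 ∈ 𝒜)
    (hram : ∀ c : (A.carrier → C₀.carrier) → Fin (r + 1), ∃ β ∈ ℬ, ∀ e₁ e₂ : OEmb A B,
      c (β ∘ e₁.1) = c (β ∘ e₂.1)) :
    ∃ C : OrdStruct.{u, v, w} L,
      (∀ χ : OEmb A C → Fin (r + 1), ∃ f : OEmb B C,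
        ∀ e₁ e₂ : OEmb A B, χ (f.comp e₁) = χ (f.comp e₂)) ∧
      ((∀ β ∈ ℬ, PHom L β) → (∀ α ∈ 𝒜, PRefl L α) → ∀ F : Bundled.{w} L.Structure,
        IrreducibleStructure L F → Nonempty (F →[L] C.carrier) →
          Nonempty (F →[L] B.carrier)) := by
  classical
  have := A.fin
  have := B.fin
  have := C₀.fin
  have : Finite (Copies L B ℬ) := by unfold Copies; infer_instance
  have hfin𝒜 : 𝒜.Finite := Set.toFinite _
  obtain ⟨V, iS, iF, π, h1, h2⟩ := partite_list L (A := A.carrier) (I := C₀.carrier) r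
    hfin𝒜.toFinset.toList
    (fun α hα => strictMap_inj A.linear C₀.linear (h𝒜 α (by simpa using hα)))
    (Copies L B ℬ) (fun x => x.1.1 x.2)
  let lo0 : LinearOrder C₀.carrier := @linearOrderOfSTO _ C₀.lt C₀.linear (Classical.decRel _)
  let loV : LinearOrder V := @linearOrderOfSTO _ (@WellOrderingRel V) inferInstance
    (Classical.decRel _)
  let emb : V ↪ C₀.carrier ×ₗ V := ⟨fun x => toLex (π x, x), fun x y h => by
    have := congrArg (fun z => (ofLex z).2) h
    exact this⟩
  let C : OrdStruct.{u, v, w} L :=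
    { carrier := V
      str := iS
      fin := iF
      lt := fun x y => emb x < emb y
      linear := (RelEmbedding.preimage emb (· < ·)).isStrictTotalOrder }
  have hlt : ∀ x y : V, π x ≠ π y → (C.lt x y ↔ C₀.lt (π x) (π y)) := by
    intro x y hxy
    show toLex (π x, x) < toLex (π y, y) ↔ π x < π y
    rw [Prod.Lex.toLex_lt_toLex]
    simp [hxy]
  have mk : ∀ {X : OrdStruct.{u, v, w} L} (f : X.carrier → V)
      (α : X.carrier → C₀.carrier), (∀ x y, C₀.lt (α x) (α y) ↔ X.lt x y) →
      (∀ x, π (f x) = α x) → ∀ x y, C.lt (f x) (f y) ↔ X.lt x y := by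
    intro X f α hα hf x y
    by_cases hxy : x = y
    · subst hxy
      exact iff_of_false (@irrefl_of _ C.lt C.linear.toIsStrictOrder.toIrrefl _)
        (@irrefl_of _ X.lt X.linear.toIsStrictOrder.toIrrefl _)
    · rw [hlt, hf, hf, hα]
      rw [hf, hf]
      exact fun h => hxy (strictMap_inj X.linear C₀.linear hα h)
  refine ⟨C, ?_, ?_⟩
  · intro χ
    let χ' : (A.carrier → V) → Fin (r + 1) := fun f =>
      if h : ∃ e : OEmb A C, (e.1 : A.carrier → V) = f then χ h.choose else 0
    have hχ' : ∀ e : OEmb A C, χ' (e.1 : A.carrier → V) = χ e := by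
      intro e
      have h : ∃ e' : OEmb A C, (e'.1 : A.carrier → V) = e.1 := ⟨e, rfl⟩
      show dite _ _ _ = _
      rw [dif_pos h]
      congr 1
      exact Subtype.ext (DFunLike.coe_injective h.choose_spec)
    obtain ⟨l, hl, hlπ, hlχ⟩ := h1 χ'
    let P := fun (α : A.carrier → C₀.carrier) (h : A.carrier → Copies L B ℬ) =>
      PEmb L h ∧ ∀ p, (h p).1.1 (h p).2 = α p
    obtain ⟨β, hβ, hβc⟩ := hram fun α => if h : ∃ h, P α h then χ' (l ∘ h.choose) else 0
    let ib : B.carrier → Copies L B ℬ := fun b => (⟨β, hβ⟩, b)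
    have hib : PEmb L ib := by
      refine ⟨fun x y h => congrArg Prod.snd h, fun n R t => ⟨?_, fun h => ⟨⟨β, hβ⟩, t, rfl, h⟩⟩⟩
      rintro ⟨β', t', e, h⟩
      have : t = t' := funext fun j => congrArg Prod.snd (congrFun e j)
      rwa [this]
    let f : OEmb B C := ⟨(hl.comp' hib).toEmb, mk (l ∘ ib) β (hℬ β hβ) fun x => hlπ (ib x)⟩
    refine ⟨f, fun e₁ e₂ => ?_⟩
    have key : ∀ e : OEmb A B, χ (f.comp e) =
        if h : ∃ h, P (β ∘ e.1) h then χ' (l ∘ h.choose) else 0 := by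
      intro e
      have h : ∃ h, P (β ∘ e.1) h := ⟨ib ∘ e.1, hib.comp' e.pemb, fun p => rfl⟩
      rw [dif_pos h, ← hχ']
      exact hlχ (β ∘ e.1) (by simpa using hcomp β hβ e) (ib ∘ e.1) h.choose (hib.comp' e.pemb)
        (fun p => rfl) h.choose_spec.1 h.choose_spec.2
    rw [key, key]
    exact hβc e₁ e₂
  · intro hB hA F hF hFC
    obtain ⟨-, h4⟩ := h2 (by
      rintro n R s ⟨β, t, rfl, ht⟩
      exact hB β.1 β.2 n R t ht) (fun α hα => hA α (by simpa using hα))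
    obtain ⟨g⟩ := h4 F hF hFC
    refine ⟨⟨fun x => (g x).2, fun f => isEmptyElim f, fun R s hs => ?_⟩⟩
    obtain ⟨β, t, e, ht⟩ := g.map_rel R s hs
    have : (fun x => (g x).2) ∘ s = t := funext fun j => congrArg Prod.snd (congrFun e j)
    rw [this]
    exact ht

theorem ramsey_fin (r : ℕ) : ∀ a b : ℕ, ∃ N : ℕ, ∀ X : Finset ℕ, N ≤ X.card →
    ∀ c : Finset ℕ → Fin (r + 1), ∃ S ⊆ X, S.card = b ∧ ∃ k, ∀ T ⊆ S, T.card = a → c T = k := by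
  intro a
  induction a with
  | zero =>
    intro b
    refine ⟨b, fun X hX c => ?_⟩
    obtain ⟨S, hS, hSc⟩ := Finset.exists_subset_card_eq hX
    refine ⟨S, hS, hSc, c ∅, fun T _ hT => ?_⟩
    rw [Finset.card_eq_zero.1 hT]
  | succ a ih =>
    have claim : ∀ m : ℕ, ∃ N : ℕ, ∀ X : Finset ℕ, N ≤ X.card →
        ∀ c : Finset ℕ → Fin (r + 1), ∃ S ⊆ X, S.card = m ∧ ∃ g : ℕ → Fin (r + 1),
          ∀ (x : ℕ) (U : Finset ℕ), (∀ u ∈ U, x < u) → insert x U ⊆ S → U.card = a →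
            c (insert x U) = g x := by
      intro m
      induction m with
      | zero =>
        refine ⟨0, fun X _ c => ⟨∅, by simp, by simp, fun _ => 0, ?_⟩⟩
        intro x U _ h
        exact absurd (h (Finset.mem_insert_self x U)) (by simp)
      | succ m ihm =>
        obtain ⟨N₁, hN₁⟩ := ihm
        obtain ⟨N₂, hN₂⟩ := ih N₁
        refine ⟨N₂ + 1, fun X hX c => ?_⟩
        have hne : X.Nonempty := Finset.card_pos.1 (by omega)
        let x₀ := X.min' hne
        have hx₀ : x₀ ∈ X := X.min'_mem hne
        obtain ⟨Y, hY, hYc, k, hk⟩ := hN₂ (X.erase x₀)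
          (by rw [Finset.card_erase_of_mem hx₀]; omega) (fun T => c (insert x₀ T))
        obtain ⟨S, hS, hSc, g, hg⟩ := hN₁ Y hYc.ge c
        have hlt : ∀ y ∈ S, x₀ < y := fun y hy => by
          have hy' := Finset.mem_erase.1 (hY (hS hy))
          exact lt_of_le_of_ne (X.min'_le y hy'.2) hy'.1.symm
        have hx₀S : x₀ ∉ S := fun h => lt_irrefl _ (hlt _ h)
        refine ⟨insert x₀ S, ?_, by rw [Finset.card_insert_of_notMem hx₀S, hSc],
          Function.update g x₀ k, ?_⟩
        · refine Finset.insert_subset hx₀ fun y hy => ?_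
          exact (Finset.mem_erase.1 (hY (hS hy))).2
        · intro x U hxU hsub hU
          have hUS : U ⊆ S := by
            intro u hu
            have h1 := hsub (Finset.mem_insert_of_mem hu)
            rcases Finset.mem_insert.1 h1 with h | h
            · have h2 := hsub (Finset.mem_insert_self x U)
              have h3 := hxU u hu
              rcases Finset.mem_insert.1 h2 with h4 | h4
              · omega
              · have := hlt x h4
                omega
            · exact h
          by_cases hx : x = x₀
          · subst hx
            rw [Function.update_self]
            exact hk U (hUS.trans hS) hU
          · rw [Function.update_of_ne hx]
            have hxS : x ∈ S := by
              rcases Finset.mem_insert.1 (hsub (Finset.mem_insert_self x U)) with h | h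
              · exact absurd h hx
              · exact h
            exact hg x U hxU (Finset.insert_subset hxS hUS) hU
    intro b
    obtain ⟨N, hN⟩ := claim ((r + 1) * b)
    refine ⟨N, fun X hX c => ?_⟩
    obtain ⟨S, hS, hSc, g, hg⟩ := hN X hX c
    obtain ⟨k, -, hk⟩ := Finset.exists_le_card_fiber_of_mul_le_card_of_maps_to
      (s := S) (t := Finset.univ) (f := g) (n := b) (fun _ _ => Finset.mem_univ _)
      Finset.univ_nonempty (by simp [hSc])
    obtain ⟨S', hS', hS'c⟩ := Finset.exists_subset_card_eq hk
    refine ⟨S', fun y hy => hS (Finset.mem_filter.1 (hS' hy)).1, hS'c, k, fun T hT hTc => ?_⟩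
    have hne : T.Nonempty := Finset.card_pos.1 (by omega)
    have hm : T.min' hne ∈ T := T.min'_mem hne
    have e : insert (T.min' hne) (T.erase (T.min' hne)) = T := Finset.insert_erase hm
    have h1 := hg (T.min' hne) (T.erase (T.min' hne))
      (fun u hu => by
        have := Finset.mem_erase.1 hu
        exact lt_of_le_of_ne (T.min'_le u this.2) this.1.symm)
      (by rw [e]; exact fun y hy => (Finset.mem_filter.1 (hS' (hT hy))).1)
      (by rw [Finset.card_erase_of_mem hm]; omega)
    rw [e] at h1
    rw [h1]
    exact (Finset.mem_filter.1 (hS' (hT hm))).2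

theorem step_one (L : FirstOrder.Language.{u, v}) [L.IsRelational]
    (A B : OrdStruct.{u, v, w} L) (r : ℕ) :
    ∃ C : OrdStruct.{u, v, w} L,
      ∀ χ : OEmb A C → Fin (r + 1), ∃ f : OEmb B C,
        ∀ e₁ e₂ : OEmb A B, χ (f.comp e₁) = χ (f.comp e₂) := by
  classical
  obtain ⟨N, hN⟩ := ramsey_fin r (Nat.card A.carrier) (Nat.card B.carrier)
  let C₀ : OrdStruct.{u, v, w} L :=
    { carrier := ULift.{w} (Fin N)
      str := { funMap := fun f => isEmptyElim f, RelMap := fun _ _ => False }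
      fin := inferInstance
      lt := fun x y => x.down < y.down
      linear := (RelEmbedding.preimage (Equiv.ulift.{w} (α := Fin N)).toEmbedding
        (· < ·)).isStrictTotalOrder }
  suffices H : ∀ c : (A.carrier → C₀.carrier) → Fin (r + 1),
      ∃ β ∈ {β : B.carrier → C₀.carrier | ∀ x y, C₀.lt (β x) (β y) ↔ B.lt x y},
        ∀ e₁ e₂ : OEmb A B, c (β ∘ e₁.1) = c (β ∘ e₂.1) by
    obtain ⟨C, hC, -⟩ := partite_main L A B C₀ r
      {α | ∀ x y, C₀.lt (α x) (α y) ↔ A.lt x y} {β | ∀ x y, C₀.lt (β x) (β y) ↔ B.lt x y}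
      (fun α h => h) (fun β h => h) (fun β hβ e x y => by
        rw [← e.2 x y]; exact hβ _ _) H
    exact ⟨C, hC⟩
  intro c
  have := A.fin
  have := B.fin
  have : Fintype A.carrier := Fintype.ofFinite _
  have : Fintype B.carrier := Fintype.ofFinite _
  let loA : LinearOrder A.carrier := @linearOrderOfSTO _ A.lt A.linear (Classical.decRel _)
  let loB : LinearOrder B.carrier := @linearOrderOfSTO _ B.lt B.linear (Classical.decRel _)
  let im : (A.carrier → C₀.carrier) → Finset ℕ := fun f =>
    Finset.univ.image fun x => ((f x).down : ℕ)
  let G := fun (f : A.carrier → C₀.carrier) => ∀ x y, C₀.lt (f x) (f y) ↔ A.lt x y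
  have hinj : ∀ f g, G f → G g → im f = im g → f = g := by
    intro f g hf hg h
    have sf : StrictMono fun x => ((f x).down : ℕ) := fun x y hxy => (hf x y).2 hxy
    have sg : StrictMono fun x => ((g x).down : ℕ) := fun x y hxy => (hg x y).2 hxy
    have := (StrictMono.range_inj sf sg).1 (by
      have := congrArg (fun s : Finset ℕ => (s : Set ℕ)) h
      simpa [im] using this)
    funext x
    have := congrFun this x
    exact ULift.ext _ _ (Fin.ext this)
  obtain ⟨S, hS, hSc, k, hk⟩ := hN (Finset.range N) (by simp) fun T =>
    if h : ∃ f, G f ∧ im f = T then c h.choose else 0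
  have hcol : ∀ f, G f → im f ⊆ S → c f = k := by
    intro f hf hfS
    have h : ∃ g, G g ∧ im g = im f := ⟨f, hf, rfl⟩
    have h1 := hk (im f) hfS (by
      rw [Finset.card_image_of_injective, Finset.card_univ, Nat.card_eq_fintype_card]
      intro x y hxy
      exact strictMap_inj A.linear C₀.linear hf (ULift.ext _ _ (Fin.ext hxy)))
    rw [dif_pos h] at h1
    rw [← h1, hinj _ _ h.choose_spec.1 hf h.choose_spec.2]
  let eB : Fin (Nat.card B.carrier) ≃o B.carrier :=
    Fintype.orderIsoFinOfCardEq _ Nat.card_eq_fintype_card.symm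
  let eS : Fin (Nat.card B.carrier) ≃o S := S.orderIsoOfFin hSc
  have hlt : ∀ i, (eS i : ℕ) < N := fun i => Finset.mem_range.1 (hS (eS i).2)
  let β : B.carrier → C₀.carrier := fun b => ⟨⟨eS (eB.symm b), hlt _⟩⟩
  have hβ : ∀ x y, C₀.lt (β x) (β y) ↔ B.lt x y := by
    intro x y
    show (eS (eB.symm x) : ℕ) < (eS (eB.symm y) : ℕ) ↔ x < y
    rw [Subtype.coe_lt_coe, eS.lt_iff_lt, eB.symm.lt_iff_lt]
  refine ⟨β, hβ, ?_⟩
  have key : ∀ e : OEmb A B, c (β ∘ e.1) = k := by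
    intro e
    refine hcol _ (fun x y => by rw [← e.2 x y]; exact hβ _ _) ?_
    intro n hn
    obtain ⟨x, -, rfl⟩ := Finset.mem_image.1 hn
    exact (eS (eB.symm (e.1 x))).2
  intro e₁ e₂
  rw [key, key]

/-- (Nešetřil–Rödl.)  For a finite relational signature `τ` and a set `ℱ` of finite
irreducible `τ`-structures, the class `Forb(ℱ) * LO` of finite linearly ordered
`τ`-structures homomorphically avoiding `ℱ` is a Ramsey class. -/
theorem stmt14 (L : FirstOrder.Language.{u, v}) [L.IsRelational]
    [Finite (Σ n, L.Relations n)]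
    (ℱ : Set (Bundled.{w} L.Structure))
    (hfin : ∀ F ∈ ℱ, Finite F) (hirr : ∀ F ∈ ℱ, IrreducibleStructure L F)
    (A B : OrdStruct.{u, v, w} L)
    (hA : AvoidsHoms L ℱ A) (hB : AvoidsHoms L ℱ B) (r : ℕ) :
    ∃ C : OrdStruct.{u, v, w} L, AvoidsHoms L ℱ C ∧
      ∀ χ : OEmb A C → Fin r, ∃ f : OEmb B C,
        ∀ e₁ e₂ : OEmb A B, χ (f.comp e₁) = χ (f.comp e₂) := by
  have idB : OEmb B B := ⟨Embedding.refl L B.carrier, fun x y => Iff.rfl⟩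
  rcases r with _ | r
  · refine ⟨B, hB, fun χ => ⟨idB, fun e₁ _ => (χ e₁).elim0⟩⟩
  obtain ⟨C₀, hC₀⟩ := step_one L A B r
  obtain ⟨C, hC, hav⟩ := partite_main L A B C₀ r
    {α | ∃ e : OEmb A C₀, (e.1 : A.carrier → C₀.carrier) = α}
    {β | ∃ e : OEmb B C₀, (e.1 : B.carrier → C₀.carrier) = β}
    (by rintro _ ⟨e, rfl⟩; exact e.2) (by rintro _ ⟨e, rfl⟩; exact e.2)
    (by rintro _ ⟨e, rfl⟩ e'; exact ⟨e.comp e', rfl⟩)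
    (by
      intro c
      obtain ⟨f, hf⟩ := hC₀ fun e => c e.1
      exact ⟨f.1, ⟨f, rfl⟩, fun e₁ e₂ => hf e₁ e₂⟩)
  refine ⟨C, fun F hF => ⟨fun g => ?_⟩, hC⟩
  obtain ⟨g'⟩ := hav (by rintro _ ⟨e, rfl⟩ n R t ht; exact (e.pemb.2 n R t).2 ht)
    (by rintro _ ⟨e, rfl⟩ n R t ht; exact (e.pemb.2 n R t).1 ht) F (hirr F hF) ⟨g⟩
  exact (hB F hF).false g'
end

section
/- The class of all finite binary branching convexly ordered C-relations has the Ramsey property: for all finite structures (A; C_A, <_A) and (B; C_B, <_B) such that C_A, C_B are binary branching C-relations and <_A, <_B are convex linear orders, and every r ∈ ℕ, there exists a finite structure (D; C_D, <_D) with C_D a binary branching C-relation and <_D a convex linear order such that (D; C_D, <_D) → ((B; C_B, <_B))^{(A; C_A, <_A)}_r. -/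
/-- `C` is a C-relation: axioms C1–C4, where `C a b c` stands for `C(a; b, c)`. -/
def IsCRel {α : Type*} (C : α → α → α → Prop) : Prop :=
  (∀ a b c, C a b c → C a c b) ∧
  (∀ a b c, C a b c → ¬ C b a c) ∧
  (∀ a b c d, C a b c → (C a d c ∨ C d b c)) ∧
  (∀ a b, a ≠ b → C a b b)

/-- A C-relation is binary branching if any three pairwise distinct elements satisfy one of
the three possible C-relationships. -/
def IsBinaryBranching {α : Type*} (C : α → α → α → Prop) : Prop :=
  ∀ a b c, a ≠ b → a ≠ c → b ≠ c → (C a b c ∨ C b a c ∨ C c a b)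

/-- A linear order is convex with respect to a C-relation. -/
def IsConvex {α : Type*} (C : α → α → α → Prop) (lt : α → α → Prop) : Prop :=
  ∀ u v w, C u v w → lt v w → ((lt u v ∧ lt v w) ∨ (lt v w ∧ lt w u))

/-- A finite binary branching convexly ordered C-relation. -/
structure COrdTree where
  carrier : Type
  fin : Finite carrier
  rel : carrier → carrier → carrier → Prop
  lt : carrier → carrier → Prop
  isC : IsCRel rel
  branching : IsBinaryBranching rel
  linear : IsStrictTotalOrder carrier lt
  convex : IsConvex rel lt

/-- Embeddings of convexly ordered C-relations: injective maps preserving the C-relation and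
the order in both directions. -/
def CEmb (A B : COrdTree) : Type :=
  {f : A.carrier → B.carrier // Function.Injective f ∧
    (∀ a b c, B.rel (f a) (f b) (f c) ↔ A.rel a b c) ∧
    (∀ a b, B.lt (f a) (f b) ↔ A.lt a b)}

/-- Composition of embeddings of convexly ordered C-relations. -/
def CEmb.comp {A B C : COrdTree} (g : CEmb B C) (f : CEmb A B) : CEmb A C :=
  ⟨g.1 ∘ f.1, g.2.1.comp f.2.1,
    fun a b c => by simp only [Function.comp_apply, g.2.2.1, f.2.2.1],
    fun a b => by simp only [Function.comp_apply, g.2.2.2, f.2.2.2]⟩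

namespace CT

inductive T : Type
  | leaf : T
  | node : T → T → T

def T.size : T → ℕ
  | .leaf => 0
  | .node a b => a.size + b.size + 1

inductive Emb : T → T → Type
  | here : Emb .leaf .leaf
  | left {a x y : T} : Emb a x → Emb a (.node x y)
  | right {a x y : T} : Emb a y → Emb a (.node x y)
  | root {a b x y : T} : Emb a x → Emb b y → Emb (.node a b) (.node x y)

def Emb.comp : {a b d : T} → Emb b d → Emb a b → Emb a d
  | _, _, _, .here, f => f
  | _, _, _, .left g, f => .left (g.comp f)
  | _, _, _, .right g, f => .right (g.comp f)
  | _, _, _, .root g _, .left f => .left (g.comp f)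
  | _, _, _, .root _ h, .right f => .right (h.comp f)
  | _, _, _, .root g h, .root f k => .root (g.comp f) (h.comp k)

theorem Emb.assoc {b c d : T} (h : Emb c d) : ∀ {a : T} (g : Emb b c) (f : Emb a b),
    (h.comp g).comp f = h.comp (g.comp f) := by
  induction h generalizing b with
  | here => intro a g f; simp [Emb.comp]
  | left h ih => intro a g f; simp [Emb.comp, ih]
  | right h ih => intro a g f; simp [Emb.comp, ih]
  | root h k ih1 ih2 =>
    intro a g f
    cases g with
    | left g => simp [Emb.comp, ih1]
    | right g => simp [Emb.comp, ih2]
    | root g g' => cases f <;> simp [Emb.comp, ih1, ih2]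

theorem Emb.exists_id (t : T) : Nonempty (Emb t t) := by
  induction t with
  | leaf => exact ⟨.here⟩
  | node a b iha ihb => exact ⟨.root iha.some ihb.some⟩

instance Emb.finite (a d : T) : Finite (Emb a d) := by
  induction d generalizing a with
  | leaf =>
    cases a with
    | leaf =>
      refine Finite.of_surjective (fun _ : Unit => Emb.here) ?_
      intro e; cases e; exact ⟨(), rfl⟩
    | node a b =>
      have : IsEmpty (Emb (.node a b) .leaf) := ⟨fun e => by cases e⟩
      infer_instance
  | node x y ihx ihy =>
    cases a with
    | leaf =>
      refine Finite.of_surjective (fun s : Emb .leaf x ⊕ Emb .leaf y =>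
        (Sum.elim Emb.left Emb.right s : Emb .leaf (.node x y))) ?_
      intro e
      cases e with
      | left e => exact ⟨.inl e, rfl⟩
      | right e => exact ⟨.inr e, rfl⟩
    | node a b =>
      refine Finite.of_surjective (fun s : (Emb (.node a b) x ⊕ Emb (.node a b) y) ⊕ (Emb a x × Emb b y) =>
        (Sum.elim (Sum.elim Emb.left Emb.right) (fun p => Emb.root p.1 p.2) s :
          Emb (.node a b) (.node x y))) ?_
      intro e
      cases e with
      | left e => exact ⟨.inl (.inl e), rfl⟩
      | right e => exact ⟨.inl (.inr e), rfl⟩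
      | root e f => exact ⟨.inr (e, f), rfl⟩

theorem exists_all {κ : Type} [Finite κ] (F : κ → T) : ∃ E, ∀ c, Nonempty (Emb (F c) E) := by
  classical
  have := Fintype.ofFinite κ
  have : ∀ s : Finset κ, ∃ E, ∀ c ∈ s, Nonempty (Emb (F c) E) := by
    intro s
    induction s using Finset.induction_on with
    | empty => exact ⟨.leaf, by simp⟩
    | insert a s ha ih =>
      obtain ⟨E, hE⟩ := ih
      refine ⟨.node (F a) E, ?_⟩
      intro c hc
      rcases Finset.mem_insert.1 hc with rfl | hc
      · exact ⟨.left (Emb.exists_id _).some⟩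
      · exact ⟨.right (hE c hc).some⟩
  obtain ⟨E, hE⟩ := this Finset.univ
  exact ⟨E, fun c => hE c (Finset.mem_univ _)⟩

def Mono {A D : T} {κ : Type} (χ : Emb A D → κ) (B : T) (c : κ) : Prop :=
  ∃ f : Emb B D, ∀ e : Emb A B, χ (f.comp e) = c

theorem Mono.trans {A D E : T} {κ : Type} {χ : Emb A D → κ} {B : T} {c : κ} (g : Emb E D)
    (h : Mono (fun e => χ (g.comp e)) B c) : Mono χ B c := by
  obtain ⟨f, hf⟩ := h
  exact ⟨g.comp f, fun e => by rw [Emb.assoc]; exact hf e⟩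

def Ram (A : T) : Prop := ∀ (κ : Type) [Finite κ] [Nonempty κ] (B : κ → T),
  ∃ D, ∀ χ : Emb A D → κ, ∃ c, Mono χ (B c) c

theorem upd {κ : Type} [DecidableEq κ] {A D : T} {χ : Emb A D → κ} {B : κ → T} {c : κ} {X : T}
    (h : ∃ c', Mono χ (Function.update B c X c') c') : Mono χ X c ∨ ∃ c', Mono χ (B c') c' := by
  obtain ⟨c', h⟩ := h
  by_cases hc : c' = c
  · subst hc
    rw [Function.update_self] at h
    exact .inl h
  · rw [Function.update_of_ne hc] at h
    exact .inr ⟨c', h⟩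

theorem sum_upd {κ : Type} [DecidableEq κ] [Fintype κ] {B : κ → T} {c : κ} {X : T}
    (h : X.size < (B c).size) :
    ∑ i, (Function.update B c X i).size < ∑ i, (B i).size := by
  apply Finset.sum_lt_sum
  · intro i _
    by_cases hc : i = c
    · subst hc; rw [Function.update_self]; exact h.le
    · rw [Function.update_of_ne hc]
  · exact ⟨c, Finset.mem_univ _, by rw [Function.update_self]; exact h⟩

theorem ram_leaf : Ram .leaf := by
  classical
  intro κ _ _ B
  have := Fintype.ofFinite κ
  induction hn : ∑ i, (B i).size using Nat.strong_induction_on generalizing B with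
  | _ n ih =>
  subst hn
  by_cases hB : ∃ c X Y, B c = .node X Y
  · obtain ⟨c, X, Y, hc⟩ := hB
    obtain ⟨D1, h1⟩ := ih _ (sum_upd (B := B) (c := c) (X := X)
      (by rw [hc]; simp only [T.size]; omega)) _ rfl
    obtain ⟨D2, h2⟩ := ih _ (sum_upd (B := B) (c := c) (X := Y)
      (by rw [hc]; simp only [T.size]; omega)) _ rfl
    refine ⟨.node D1 D2, fun χ => ?_⟩
    rcases upd (h1 fun e => χ (.left e)) with ⟨f1, hf1⟩ | ⟨c', f, hf⟩
    · rcases upd (h2 fun e => χ (.right e)) with ⟨f2, hf2⟩ | ⟨c', f, hf⟩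
      · refine ⟨c, ?_⟩
        rw [hc]
        refine ⟨.root f1 f2, fun e => ?_⟩
        cases e with
        | left e => exact hf1 e
        | right e => exact hf2 e
      · exact ⟨c', .right f, hf⟩
    · exact ⟨c', .left f, hf⟩
  · refine ⟨.leaf, fun χ => ⟨χ .here, ?_⟩⟩
    have : B (χ .here) = .leaf := by
      cases h : B (χ .here) with
      | leaf => rfl
      | node X Y => exact (hB ⟨_, _, _, h⟩).elim
    rw [this]
    exact ⟨.here, fun e => by cases e; rfl⟩

theorem ram_node {A1 A2 : T} (r1 : Ram A1) (r2 : Ram A2) : Ram (.node A1 A2) := by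
  classical
  intro κ _ _ B
  have := Fintype.ofFinite κ
  induction hn : ∑ i, (B i).size using Nat.strong_induction_on generalizing B with
  | _ n ih =>
  subst hn
  by_cases hB : ∃ c, B c = .leaf
  · obtain ⟨c, hc⟩ := hB
    refine ⟨.leaf, fun χ => ⟨c, ?_⟩⟩
    rw [hc]
    exact ⟨.here, fun e => by cases e⟩
  · have hB' : ∀ c, ∃ X Y, B c = .node X Y := by
      intro c
      cases h : B c with
      | leaf => exact (hB ⟨_, h⟩).elim
      | node X Y => exact ⟨X, Y, rfl⟩
    choose X Y hXY using hB'
    have H1 : ∀ c, ∃ D, ∀ χ : Emb (.node A1 A2) D → κ, ∃ c', Mono χ (Function.update B c (X c) c') c' :=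
      fun c => ih _ (sum_upd (B := B) (c := c) (X := X c)
      (by rw [hXY c]; simp only [T.size]; omega)) _ rfl
    have H2 : ∀ c, ∃ D, ∀ χ : Emb (.node A1 A2) D → κ, ∃ c', Mono χ (Function.update B c (Y c) c') c' :=
      fun c => ih _ (sum_upd (B := B) (c := c) (X := Y c)
      (by rw [hXY c]; simp only [T.size]; omega)) _ rfl
    choose F1 hF1 using H1
    choose F2 hF2 using H2
    obtain ⟨E1, hE1⟩ := exists_all F1
    obtain ⟨E2, hE2⟩ := exists_all F2
    obtain ⟨D1, hD1⟩ := r1 κ (fun _ => E1)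
    obtain ⟨D2, hD2⟩ := r2 (Emb A1 D1 → κ) (fun _ => E2)
    refine ⟨.node D1 D2, fun χ => ?_⟩
    obtain ⟨φ, f2, hf2⟩ := hD2 (fun e2 e1 => χ (.root e1 e2))
    obtain ⟨c, f1, hf1⟩ := hD1 φ
    obtain ⟨i⟩ := hE1 c
    obtain ⟨j⟩ := hE2 c
    rcases upd (hF1 c fun e => χ ((Emb.left (f1.comp i)).comp e)) with ⟨g1, hg1⟩ | ⟨c', h⟩
    · rcases upd (hF2 c fun e => χ ((Emb.right (f2.comp j)).comp e)) with ⟨g2, hg2⟩ | ⟨c', h⟩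
      · refine ⟨c, ?_⟩
        rw [hXY c]
        refine ⟨.root (f1.comp (i.comp g1)) (f2.comp (j.comp g2)), fun e => ?_⟩
        cases e with
        | left e => simpa [Emb.comp, Emb.assoc] using hg1 e
        | right e => simpa [Emb.comp, Emb.assoc] using hg2 e
        | root e e' =>
          have h1 := congrFun (hf2 ((j.comp g2).comp e')) (f1.comp ((i.comp g1).comp e))
          have h2 := hf1 ((i.comp g1).comp e)
          simp only [Emb.comp, Emb.assoc] at h1 h2 ⊢
          rw [h1, h2]
      · exact ⟨c', h.trans⟩
    · exact ⟨c', h.trans⟩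

theorem ram (A : T) : Ram A := by
  induction A with
  | leaf => exact ram_leaf
  | node a b iha ihb => exact ram_node iha ihb

/-! Leaves -/

def Lv : T → Type
  | .leaf => Unit
  | .node a b => Lv a ⊕ Lv b

def rel : (t : T) → Lv t → Lv t → Lv t → Prop
  | .leaf => fun _ _ _ => False
  | .node a b => fun u v w => match u, v, w with
    | .inl u, .inl v, .inl w => rel a u v w
    | .inr u, .inr v, .inr w => rel b u v w
    | .inl _, .inr _, .inr _ => True
    | .inr _, .inl _, .inl _ => True
    | _, _, _ => False

def lt : (t : T) → Lv t → Lv t → Prop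
  | .leaf => fun _ _ => False
  | .node a b => fun u v => match u, v with
    | .inl u, .inl v => lt a u v
    | .inr u, .inr v => lt b u v
    | .inl _, .inr _ => True
    | .inr _, .inl _ => False

theorem lv_finite (t : T) : Finite (Lv t) := by
  induction t with
  | leaf => exact inferInstanceAs (Finite Unit)
  | node a b iha ihb => exact inferInstanceAs (Finite (Lv a ⊕ Lv b))

theorem lv_nonempty (t : T) : Nonempty (Lv t) := by
  induction t with
  | leaf => exact ⟨()⟩
  | node a b iha ihb => exact ⟨Sum.inl iha.some⟩

theorem rel_isC (t : T) : IsCRel (rel t) := by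
  induction t with
  | leaf => exact ⟨by simp [rel], by simp [rel], by simp [rel], fun a b h => (h rfl).elim⟩
  | node a b iha ihb =>
    obtain ⟨a1, a2, a3, a4⟩ := iha
    obtain ⟨b1, b2, b3, b4⟩ := ihb
    refine ⟨?_, ?_, ?_, ?_⟩
    · rintro (x | x) (y | y) (z | z) <;> simp only [rel] <;> grind
    · rintro (x | x) (y | y) (z | z) <;> simp only [rel] <;> grind
    · rintro (x | x) (y | y) (z | z) (w | w) <;> simp only [rel] <;> grind
    · rintro (x | x) (y | y) h <;> simp only [rel]
      · exact a4 _ _ fun e => h (by rw [e])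
      · exact b4 _ _ fun e => h (by rw [e])

theorem rel_bb (t : T) : IsBinaryBranching (rel t) := by
  induction t with
  | leaf => exact fun a b c h => (h rfl).elim
  | node a b iha ihb =>
    rintro (x | x) (y | y) (z | z) h1 h2 h3 <;> simp only [rel, true_or, or_true]
    · exact iha _ _ _ (fun e => h1 (by rw [e])) (fun e => h2 (by rw [e])) (fun e => h3 (by rw [e]))
    · exact ihb _ _ _ (fun e => h1 (by rw [e])) (fun e => h2 (by rw [e])) (fun e => h3 (by rw [e]))

theorem rel_convex (t : T) : IsConvex (rel t) (lt t) := by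
  induction t with
  | leaf => intro u v w h; exact h.elim
  | node a b iha ihb =>
    rintro (x | x) (y | y) (z | z) <;> simp only [rel, lt]
    all_goals first | exact iha _ _ _ | exact ihb _ _ _ | simp

theorem lt_irrefl (t : T) : ∀ x, ¬ lt t x x := by
  induction t with
  | leaf => intro x h; exact h
  | node a b iha ihb =>
    rintro (x | x) h
    · exact iha _ h
    · exact ihb _ h

theorem lt_trans (t : T) : ∀ x y z, lt t x y → lt t y z → lt t x z := by
  induction t with
  | leaf => intro x y z h; exact h.elim
  | node a b iha ihb =>
    rintro (x | x) (y | y) (z | z) <;> simp only [lt]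
    all_goals first | exact iha _ _ _ | exact ihb _ _ _ | simp

theorem lt_tri (t : T) : ∀ x y, ¬ lt t x y → ¬ lt t y x → x = y := by
  induction t with
  | leaf => intro x y _ _; rfl
  | node a b iha ihb =>
    rintro (x | x) (y | y) h1 h2
    · exact congrArg Sum.inl (iha _ _ h1 h2)
    · exact (h1 trivial).elim
    · exact (h2 trivial).elim
    · exact congrArg Sum.inr (ihb _ _ h1 h2)

def S (t : T) : COrdTree where
  carrier := Lv t
  fin := lv_finite t
  rel := rel t
  lt := lt t
  isC := rel_isC t
  branching := rel_bb t
  linear := { trichotomous := lt_tri t, irrefl := lt_irrefl t, trans := lt_trans t }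
  convex := rel_convex t

def Emb.re : {a d : T} → Emb a d → Lv a → Lv d
  | _, _, .here, x => x
  | _, _, .left f, x => Sum.inl (f.re x)
  | _, _, .right f, x => Sum.inr (f.re x)
  | _, _, .root f _, .inl x => Sum.inl (f.re x)
  | _, _, .root _ g, .inr x => Sum.inr (g.re x)

theorem Emb.re_comp {b d : T} (g : Emb b d) : ∀ {a : T} (f : Emb a b) (x : Lv a),
    (g.comp f).re x = g.re (f.re x) := by
  induction g with
  | here => intro a f x; simp [Emb.comp, Emb.re]
  | left h ih => intro a f x; exact congrArg Sum.inl (ih f x)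
  | right h ih => intro a f x; exact congrArg Sum.inr (ih f x)
  | root h k ih1 ih2 =>
    intro a f x
    cases f with
    | left g => exact congrArg Sum.inl (ih1 g x)
    | right g => exact congrArg Sum.inr (ih2 g x)
    | root g g' =>
      rcases x with x | x
      · exact congrArg Sum.inl (ih1 g x)
      · exact congrArg Sum.inr (ih2 g' x)

theorem Emb.re_rel {a d : T} (f : Emb a d) :
    ∀ x y z, rel d (f.re x) (f.re y) (f.re z) ↔ rel a x y z := by
  induction f with
  | here => intro x y z; rfl
  | left h ih => intro x y z; exact ih x y z
  | right h ih => intro x y z; exact ih x y z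
  | root h k ih1 ih2 =>
    rintro (x | x) (y | y) (z | z) <;> simp only [rel, Emb.re]
    · exact ih1 x y z
    · exact ih2 x y z

theorem Emb.re_lt {a d : T} (f : Emb a d) :
    ∀ x y, lt d (f.re x) (f.re y) ↔ lt a x y := by
  induction f with
  | here => intro x y; rfl
  | left h ih => intro x y; exact ih x y
  | right h ih => intro x y; exact ih x y
  | root h k ih1 ih2 =>
    rintro (x | x) (y | y) <;> simp only [lt, Emb.re]
    · exact ih1 x y
    · exact ih2 x y

theorem inj_of_lt {a d : T} {f : Lv a → Lv d} (h : ∀ x y, lt d (f x) (f y) ↔ lt a x y) :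
    Function.Injective f := by
  intro x y e
  apply lt_tri
  · rw [← h, e]; exact lt_irrefl _ _
  · rw [← h, e]; exact lt_irrefl _ _

theorem surj {a d : T} (f : Lv a → Lv d) 
    (hr : ∀ x y z, rel d (f x) (f y) (f z) ↔ rel a x y z)
    (hl : ∀ x y, lt d (f x) (f y) ↔ lt a x y) : ∃ e : Emb a d, ∀ x, e.re x = f x := by
  induction d generalizing a with
  | leaf =>
    cases a with
    | leaf => exact ⟨.here, fun x => rfl⟩
    | node a b =>
      exact ((hl (Sum.inl (lv_nonempty a).some) (Sum.inr (lv_nonempty b).some)).2 trivial).elim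
  | node X Y ihX ihY =>
    by_cases h1 : ∀ x, ∃ y : Lv X, f x = Sum.inl y
    · choose g hg using h1
      obtain ⟨e, he⟩ := ihX g (fun x y z => by rw [← hr, hg, hg, hg]; rfl)
        (fun x y => by rw [← hl, hg, hg]; rfl)
      exact ⟨.left e, fun x => by rw [hg, ← he]; rfl⟩
    by_cases h2 : ∀ x, ∃ y : Lv Y, f x = Sum.inr y
    · choose g hg using h2
      obtain ⟨e, he⟩ := ihY g (fun x y z => by rw [← hr, hg, hg, hg]; rfl)
        (fun x y => by rw [← hl, hg, hg]; rfl)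
      exact ⟨.right e, fun x => by rw [hg, ← he]; rfl⟩
    have h1' : ∃ q, ∃ y : Lv Y, f q = Sum.inr y := by
      push Not at h1
      obtain ⟨q, hq⟩ := h1
      refine ⟨q, ?_⟩
      rcases h : f q with y | y
      · exact (hq y h).elim
      · exact ⟨y, rfl⟩
    have h2' : ∃ p, ∃ y : Lv X, f p = Sum.inl y := by
      push Not at h2
      obtain ⟨q, hq⟩ := h2
      refine ⟨q, ?_⟩
      rcases h : f q with y | y
      · exact ⟨y, rfl⟩
      · exact (hq y h).elim
    obtain ⟨q, q', hq⟩ := h1'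
    obtain ⟨p, p', hp⟩ := h2'
    have hpq : lt a p q := by rw [← hl, hp, hq]; trivial
    cases a with
    | leaf => exact hpq.elim
    | node a b =>
      have key : ∀ z u v s t, f u = Sum.inl s → f v = Sum.inr t → ¬ rel (.node a b) z u v := by
        intro z u v s t hs ht h
        rw [← hr, hs, ht] at h
        revert h
        generalize f z = k
        rcases k with y | y <;> exact fun h => h
      rcases p with p | p <;> rcases q with q | q
      · exact (key (Sum.inr (lv_nonempty b).some) _ _ _ _ hp hq trivial).elim
      · have hL : ∀ x : Lv a, ∃ y : Lv X, f (Sum.inl x) = Sum.inl y := by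
          intro x
          rcases h : f (Sum.inl x) with y | y
          · exact ⟨y, rfl⟩
          · exact (key (Sum.inr q) _ _ _ _ hp h trivial).elim
        have hR : ∀ x : Lv b, ∃ y : Lv Y, f (Sum.inr x) = Sum.inr y := by
          intro x
          rcases h : f (Sum.inr x) with y | y
          · exact (key (Sum.inl p) _ _ _ _ h hq trivial).elim
          · exact ⟨y, rfl⟩
        choose g hg using hL
        choose k hk using hR
        obtain ⟨e, he⟩ := ihX g
          (fun x y z => by
            have := hr (Sum.inl x) (Sum.inl y) (Sum.inl z)
            rw [hg, hg, hg] at this; exact this)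
          (fun x y => by
            have := hl (Sum.inl x) (Sum.inl y)
            rw [hg, hg] at this; exact this)
        obtain ⟨e', he'⟩ := ihY k
          (fun x y z => by
            have := hr (Sum.inr x) (Sum.inr y) (Sum.inr z)
            rw [hk, hk, hk] at this; exact this)
          (fun x y => by
            have := hl (Sum.inr x) (Sum.inr y)
            rw [hk, hk] at this; exact this)
        refine ⟨.root e e', ?_⟩
        rintro (x | x)
        · rw [hg, ← he]; rfl
        · rw [hk, ← he']; rfl
      · exact hpq.elim
      · exact (key (Sum.inl (lv_nonempty a).some) _ _ _ _ hp hq trivial).elim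

/-! Every nonempty structure is a tree. -/

def sub (A : COrdTree) (P : A.carrier → Prop) : COrdTree where
  carrier := {x // P x}
  fin := have := A.fin; inferInstance
  rel := fun a b c => A.rel a b c
  lt := fun a b => A.lt a b
  isC := ⟨fun a b c => A.isC.1 a b c, fun a b c => A.isC.2.1 a b c,
    fun a b c d => A.isC.2.2.1 a b c d, fun a b h => A.isC.2.2.2 a b fun e => h (Subtype.ext e)⟩
  branching := fun a b c h1 h2 h3 => A.branching a b c (fun e => h1 (Subtype.ext e))
    (fun e => h2 (Subtype.ext e)) (fun e => h3 (Subtype.ext e))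
  linear :=
    { trichotomous := fun a b h1 h2 => Subtype.ext (A.linear.trichotomous _ _ h1 h2)
      irrefl := fun a => A.linear.irrefl a.1
      trans := fun a b c => A.linear.trans a.1 b.1 c.1 }
  convex := fun a b c => A.convex a b c

theorem exists_minmax (A : COrdTree) [Nonempty A.carrier] :
    ∃ m M, ∀ x, (x = m ∨ A.lt m x) ∧ (x = M ∨ A.lt x M) := by
  classical
  have := A.fin
  have := A.linear
  letI : LinearOrder A.carrier := linearOrderOfSTO A.lt
  obtain ⟨m, hm⟩ := Finite.exists_min (id : A.carrier → A.carrier)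
  obtain ⟨M, hM⟩ := Finite.exists_max (id : A.carrier → A.carrier)
  refine ⟨m, M, fun x => ⟨?_, ?_⟩⟩
  · rcases (hm x).lt_or_eq with h | h
    · exact .inr h
    · exact .inl h.symm
  · rcases (hM x).lt_or_eq with h | h
    · exact .inr h
    · exact .inl h

theorem split (A : COrdTree) [Nonempty A.carrier] (hA : ∃ x y : A.carrier, x ≠ y) :
    ∃ P : A.carrier → Prop, (∃ x, P x) ∧ (∃ x, ¬ P x) ∧
      (∀ x z, P x → ¬ P z → A.lt x z) ∧
      (∀ x y z, P x → P y → ¬ P z → A.rel z x y) ∧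
      (∀ x y z, ¬ P x → ¬ P y → P z → A.rel z x y) := by
  obtain ⟨m, M, hmM⟩ := exists_minmax A
  obtain ⟨c1, c2, c3, c4⟩ := A.isC
  have bb := A.branching
  have cv := A.convex
  have irr : ∀ x, ¬ A.lt x x := A.linear.irrefl
  have tr : ∀ x y z, A.lt x y → A.lt y z → A.lt x z := A.linear.trans
  have hne : m ≠ M := by
    rintro rfl
    obtain ⟨x, y, hxy⟩ := hA
    have hx : ∀ x, x = m := by
      intro x
      rcases (hmM x).1 with h | h
      · exact h
      · rcases (hmM x).2 with h' | h'
        · exact h'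
        · exact (irr _ (tr _ _ _ h h')).elim
    exact hxy ((hx x).trans (hx y).symm)
  have hlt : A.lt m M := ((hmM m).2).resolve_left hne
  have tri : ∀ a x y z, A.rel a x y → A.rel a y z → A.rel a x z := by
    intro a x y z h1 h2
    rcases c3 a y z x h2 with h | h
    · exact h
    · rcases c3 a y x z (c1 _ _ _ h1) with h' | h'
      · exact c1 _ _ _ h'
      · exact (c2 _ _ _ (c1 _ _ _ h) (c1 _ _ _ h')).elim
  have hR : ∀ z, ¬ A.rel M m z → A.rel m M z := by
    intro z hz
    by_cases h1 : z = m
    · subst h1; exact (hz (c4 _ _ hne.symm)).elim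
    by_cases h2 : z = M
    · subst h2; exact c4 _ _ hne
    rcases bb m M z hne (Ne.symm h1) (Ne.symm h2) with h | h | h
    · exact h
    · exact (hz h).elim
    · have a1 := ((hmM z).1).resolve_left h1
      have a2 := ((hmM z).2).resolve_left h2
      rcases cv _ _ _ h hlt with h | h
      · exact (irr _ (tr _ _ _ h.1 a1)).elim
      · exact (irr _ (tr _ _ _ h.2 a2)).elim
  have hLL : ∀ x y z, A.rel M m x → A.rel M m y → ¬ A.rel M m z → A.rel z x y := by
    intro x y z hx hy hz
    have h := tri _ _ _ _ (c1 _ _ _ hx) hy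
    rcases c3 M x y z h with h' | h'
    · exact (hz (tri _ _ _ _ hy (c1 _ _ _ h'))).elim
    · exact h'
  have hRR : ∀ x y z, ¬ A.rel M m x → ¬ A.rel M m y → A.rel M m z → A.rel z x y := by
    intro x y z hx hy hz
    have hx := hR x hx
    have hy := hR y hy
    have h := tri _ _ _ _ (c1 _ _ _ hx) hy
    rcases c3 m x y z h with h' | h'
    · exact (c2 _ _ _ hz (tri _ _ _ _ hy (c1 _ _ _ h'))).elim
    · exact h'
  have hm : A.rel M m m := c4 _ _ hne.symm
  refine ⟨fun x => A.rel M m x, ⟨m, hm⟩, ⟨M, fun h => c2 _ _ _ (c1 _ _ _ h) (c1 _ _ _ h)⟩,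
    ?_, hLL, hRR⟩
  intro x z hx hz
  have hzm : A.lt m z := ((hmM z).1).resolve_left (by rintro rfl; exact hz hm)
  rcases (hmM x).1 with rfl | h
  · exact hzm
  · rcases cv _ _ _ (hLL m x z hm hx hz) h with h' | h'
    · exact (irr _ (tr _ _ _ h'.1 hzm)).elim
    · exact h'.2

theorem exists_tree (n : ℕ) : ∀ (A : COrdTree), Nonempty A.carrier → Nat.card A.carrier = n →
    ∃ (t : T) (e : Lv t ≃ A.carrier), (∀ x y z, A.rel (e x) (e y) (e z) ↔ rel t x y z) ∧
      (∀ x y, A.lt (e x) (e y) ↔ lt t x y) := by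
  classical
  induction n using Nat.strong_induction_on with
  | _ n ih =>
  intro A hne hn
  have := A.fin
  obtain ⟨c1, c2, c3, c4⟩ := A.isC
  have irr : ∀ x, ¬ A.lt x x := A.linear.irrefl
  have tr : ∀ x y z, A.lt x y → A.lt y z → A.lt x z := A.linear.trans
  by_cases hA : ∃ x y : A.carrier, x ≠ y
  · obtain ⟨P, ⟨p, hp⟩, ⟨q, hq⟩, h1, h2, h3⟩ := split A hA
    obtain ⟨t1, e1, r1, l1⟩ := ih _ (by
      rw [← hn]; exact Finite.card_subtype_lt (p := P) hq) (sub A P) ⟨⟨p, hp⟩⟩ rfl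
    obtain ⟨t2, e2, r2, l2⟩ := ih _ (by
      rw [← hn]; exact Finite.card_subtype_lt (p := fun x => ¬ P x) (not_not.2 hp))
      (sub A fun x => ¬ P x) ⟨⟨q, hq⟩⟩ rfl
    let e : Lv (.node t1 t2) ≃ A.carrier := (Equiv.sumCongr e1 e2).trans (Equiv.sumCompl P)
    have ea : ∀ x, e (Sum.inl x) = (e1 x).1 := fun x => rfl
    have eb : ∀ x, e (Sum.inr x) = (e2 x).1 := fun x => rfl
    have pa : ∀ x, P (e1 x).1 := fun x => (e1 x).2
    have pb : ∀ x, ¬ P (e2 x).1 := fun x => (e2 x).2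
    refine ⟨.node t1 t2, e, ?_, ?_⟩
    · rintro (x | x) (y | y) (z | z) <;> simp only [ea, eb, rel, iff_true, iff_false]
      · exact r1 x y z
      · exact fun h => c2 _ _ _ h (c1 _ _ _ (h2 _ _ _ (pa _) (pa _) (pb _)) |> fun k =>
          (c2 _ _ _ (c1 _ _ _ h) (c1 _ _ _ k)).elim)
      · exact fun h => c2 _ _ _ h (h2 _ _ _ (pa _) (pa _) (pb _))
      · exact h3 _ _ _ (pb _) (pb _) (pa _)
      · exact h2 _ _ _ (pa _) (pa _) (pb _)
      · exact fun h => c2 _ _ _ h (h3 _ _ _ (pb _) (pb _) (pa _))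
      · exact fun h => c2 _ _ _ (c1 _ _ _ h) (h3 _ _ _ (pb _) (pb _) (pa _))
      · exact r2 x y z
    · rintro (x | x) (y | y) <;> simp only [ea, eb, lt, iff_true, iff_false]
      · exact l1 x y
      · exact h1 _ _ (pa _) (pb _)
      · exact fun h => irr _ (tr _ _ _ h (h1 _ _ (pa _) (pb _)))
      · exact l2 x y
  · push Not at hA
    have a := hne.some
    refine ⟨.leaf, ⟨fun _ => a, fun _ => (), fun _ => rfl, fun _ => hA _ _⟩, ?_, ?_⟩
    · exact fun x y z => ⟨fun h => c2 _ _ _ h h, fun h => h.elim⟩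
    · exact fun x y => ⟨fun h => irr _ h, fun h => h.elim⟩

def idEmb (B : COrdTree) : CEmb B B := ⟨id, fun _ _ h => h, fun _ _ _ => Iff.rfl, fun _ _ => Iff.rfl⟩

end CT

open CT in
/-- (Milliken; Leeb.)  The class of all finite binary branching convexly ordered C-relations
is a Ramsey class. -/
theorem stmt15 (A B : COrdTree) (r : ℕ) :
    ∃ D : COrdTree, ∀ χ : CEmb A D → Fin r,
      ∃ f : CEmb B D, ∀ e₁ e₂ : CEmb A B, χ (f.comp e₁) = χ (f.comp e₂) := by
  by_cases hr : r = 0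
  · subst hr
    exact ⟨B, fun χ => ⟨idEmb B, fun e => (χ e).elim0⟩⟩
  by_cases hA : Nonempty A.carrier
  swap
  · refine ⟨B, fun χ => ⟨idEmb B, fun e₁ e₂ => ?_⟩⟩
    congr 1
    apply Subtype.ext
    funext x
    exact (hA ⟨x⟩).elim
  by_cases hB : Nonempty B.carrier
  swap
  · exact ⟨B, fun χ => ⟨idEmb B, fun e₁ e₂ => (hB ⟨e₁.1 hA.some⟩).elim⟩⟩
  have : Nonempty (Fin r) := ⟨⟨0, Nat.pos_of_ne_zero hr⟩⟩
  obtain ⟨a, i, ir, il⟩ := exists_tree _ A hA rfl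
  obtain ⟨b, j, jr, jl⟩ := exists_tree _ B hB rfl
  obtain ⟨d, hd⟩ := ram a (Fin r) (fun _ => b)
  refine ⟨S d, fun χ => ?_⟩
  let up : Emb a d → CEmb A (S d) := fun e => ⟨fun x => e.re (i.symm x),
    fun x y h => i.symm.injective (inj_of_lt e.re_lt h),
    fun x y z => by
      have := (e.re_rel (i.symm x) (i.symm y) (i.symm z)).trans (ir _ _ _).symm
      simp only [Equiv.apply_symm_apply] at this
      exact this,
    fun x y => by
      have := (e.re_lt (i.symm x) (i.symm y)).trans (il _ _).symm
      simp only [Equiv.apply_symm_apply] at this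
      exact this⟩
  obtain ⟨c, f, hf⟩ := hd fun e => χ (up e)
  refine ⟨⟨fun x => f.re (j.symm x),
    fun x y h => j.symm.injective (inj_of_lt f.re_lt h),
    fun x y z => by
      have := (f.re_rel (j.symm x) (j.symm y) (j.symm z)).trans (jr _ _ _).symm
      simp only [Equiv.apply_symm_apply] at this
      exact this,
    fun x y => by
      have := (f.re_lt (j.symm x) (j.symm y)).trans (jl _ _).symm
      simp only [Equiv.apply_symm_apply] at this
      exact this⟩, ?_⟩
  suffices h : ∀ e : CEmb A B, χ (CEmb.comp _ e) = c from fun e₁ e₂ => (h e₁).trans (h e₂).symm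
  intro e
  obtain ⟨k, hk⟩ := surj (a := a) (d := b) (fun x => j.symm (e.1 (i x)))
    (fun x y z => by rw [← jr, ← ir, ← e.2.2.1]; simp)
    (fun x y => by rw [← jl, ← il, ← e.2.2.2]; simp)
  rw [← hf k]
  congr 1
  apply Subtype.ext
  funext x
  simp [CEmb.comp, up, Emb.re_comp, hk]
  rfl
end
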